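/- For every C₀>0 there exists a constant N=N(C₀) such that the following holds. Let κ:[0,∞)→[0,1] be smooth, nonincreasing with κ'≥−C₀, κ=1 on [0,1/2], κ supported in [0,1), and let ζ(x)=κ(|x|) satisfy ∫_{ℝ³}ζ² dx=1; set ζ_R(x)=R^{−3/2}ζ(x/R). Let (u,Π) be a classical axisymmetric solution of the 3D Navier–Stokes equations on Q(1), let 0<R≤1/4 with J_R>0, and let h be the associated normalized function. Then for every t with −R²/4 ≤ t < 0, −∫_{ℝ³} ln h(x,t)·ζ_R(x)² dx ≤ N·(1+A(R))³. -/

import Mathlib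

open Real MeasureTheory Set
open scoped ENNReal
noncomputable section

abbrev E3 := EuclideanSpace ℝ (Fin 3)

/-- `i`-th standard basis vector of `ℝ³`. -/
def ee (i : Fin 3) : E3 := EuclideanSpace.single i 1

/-- partial derivative of a scalar function in the direction `eᵢ`. -/
def pd (f : E3 → ℝ) (i : Fin 3) (x : E3) : ℝ := fderiv ℝ f x (ee i)

/-- Laplacian of a scalar function. -/
def lap (f : E3 → ℝ) (x : E3) : ℝ := ∑ i, pd (fun y => pd f i y) i x

/-- parabolic cylinder `Q(z₀,R) = B(x₀,R) × (t₀ - R², t₀)`. -/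
def Qyl (z₀ : E3 × ℝ) (R : ℝ) : Set (E3 × ℝ) :=
  (Metric.ball z₀.1 R) ×ˢ (Ioo (z₀.2 - R ^ 2) z₀.2)

/-- `(u, P)` is a classical solution of the 3D Navier–Stokes equations on the open set `U`,
which contains the closure of `Q(1)`. -/
structure IsNSQ1 (u : E3 → ℝ → E3) (P : E3 → ℝ → ℝ) (U : Set (E3 × ℝ)) : Prop where
  open_U : IsOpen U
  subset_U : closure (Qyl (0, 0) 1) ⊆ U
  smooth_u : ContDiffOn ℝ (⊤ : ℕ∞) (fun z : E3 × ℝ => u z.1 z.2) U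
  smooth_P : ContDiffOn ℝ (⊤ : ℕ∞) (fun z : E3 × ℝ => P z.1 z.2) U
  momentum : ∀ x : E3, ∀ t : ℝ, (x, t) ∈ U → ∀ j : Fin 3,
    deriv (fun s => u x s j) t
      + (∑ i, u x t i * pd (fun y => u y t j) i x)
      - lap (fun y => u y t j) x
      + pd (fun y => P y t) j x = 0
  divfree : ∀ x : E3, ∀ t : ℝ, (x, t) ∈ U → ∑ i, pd (fun y => u y t i) i x = 0

/-- `(u, P)` is axially symmetric on `U`: in cylindrical coordinates
`u = uʳ eᵣ + uᶿ e_θ + u³ e₃` and `P = p(r, x₃, t)`. -/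
def IsAxisym (u : E3 → ℝ → E3) (P : E3 → ℝ → ℝ) (U : Set (E3 × ℝ)) : Prop :=
  ∃ ur uθ u3 pp : ℝ → ℝ → ℝ → ℝ,
    ∀ x : E3, ∀ t : ℝ, (x, t) ∈ U → x 0 ^ 2 + x 1 ^ 2 ≠ 0 →
      u x t 0 = ur (Real.sqrt (x 0 ^ 2 + x 1 ^ 2)) (x 2) t
                  * (x 0 / Real.sqrt (x 0 ^ 2 + x 1 ^ 2))
                - uθ (Real.sqrt (x 0 ^ 2 + x 1 ^ 2)) (x 2) t
                  * (x 1 / Real.sqrt (x 0 ^ 2 + x 1 ^ 2)) ∧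
      u x t 1 = ur (Real.sqrt (x 0 ^ 2 + x 1 ^ 2)) (x 2) t
                  * (x 1 / Real.sqrt (x 0 ^ 2 + x 1 ^ 2))
                + uθ (Real.sqrt (x 0 ^ 2 + x 1 ^ 2)) (x 2) t
                  * (x 0 / Real.sqrt (x 0 ^ 2 + x 1 ^ 2)) ∧
      u x t 2 = u3 (Real.sqrt (x 0 ^ 2 + x 1 ^ 2)) (x 2) t ∧
      P x t = pp (Real.sqrt (x 0 ^ 2 + x 1 ^ 2)) (x 2) t

/-- `Γ = r uᶿ = x₁ u₂ - x₂ u₁`. -/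
def Gam (u : E3 → ℝ → E3) (x : E3) (t : ℝ) : ℝ := x 0 * u x t 1 - x 1 * u x t 0

/-- Cartesian components of `b = uʳ eᵣ + u³ e₃ = u - uᶿ e_θ`. -/
def bcomp (u : E3 → ℝ → E3) (x : E3) (t : ℝ) : Fin 3 → ℝ :=
  ![u x t 0 + x 1 * Gam u x t / (x 0 ^ 2 + x 1 ^ 2),
    u x t 1 - x 0 * Gam u x t / (x 0 ^ 2 + x 1 ^ 2),
    u x t 2]

/-- Euclidean norm of `b`. -/
def bnorm (u : E3 → ℝ → E3) (x : E3) (t : ℝ) : ℝ :=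
  Real.sqrt (∑ i, (bcomp u x t i) ^ 2)

/-- `A(z₀,R)`. -/
def AA (u : E3 → ℝ → E3) (z₀ : E3 × ℝ) (R : ℝ) : ℝ :=
  ⨆ t ∈ Ioo (z₀.2 - R ^ 2) z₀.2, R⁻¹ * ∫ x in Metric.ball z₀.1 R, ‖u x t‖ ^ 2

/-- `E(z₀,R)`. -/
def EE (u : E3 → ℝ → E3) (z₀ : E3 × ℝ) (R : ℝ) : ℝ :=
  R⁻¹ * ∫ t in Ioo (z₀.2 - R ^ 2) z₀.2, ∫ x in Metric.ball z₀.1 R,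
    ∑ j, ∑ i, (pd (fun y => u y t j) i x) ^ 2

/-- `C(z₀,R)`. -/
def CC (u : E3 → ℝ → E3) (z₀ : E3 × ℝ) (R : ℝ) : ℝ :=
  (R ^ 2)⁻¹ * ∫ t in Ioo (z₀.2 - R ^ 2) z₀.2, ∫ x in Metric.ball z₀.1 R, ‖u x t‖ ^ 3

/-- `D(z₀,R)`. -/
def DD (P : E3 → ℝ → ℝ) (z₀ : E3 × ℝ) (R : ℝ) : ℝ :=
  (R ^ 2)⁻¹ * ∫ t in Ioo (z₀.2 - R ^ 2) z₀.2, ∫ x in Metric.ball z₀.1 R, |P x t| ^ (3/2 : ℝ)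

/-- `𝓔(z₀,R) = A + E + D`. -/
def EEE (u : E3 → ℝ → E3) (P : E3 → ℝ → ℝ) (z₀ : E3 × ℝ) (R : ℝ) : ℝ :=
  AA u z₀ R + EE u z₀ R + DD P z₀ R

/-- the weight `ω(R) = (ln ln (100/R))⁻¹`. -/
def omg (R : ℝ) : ℝ := (Real.log (Real.log (100 / R)))⁻¹

/-- `G(z₀,R) = R^{1-3/p-2/q} ‖b‖_{L^{p,q}(Q(z₀,R))}` (space norm `Lᵖ`, time norm `L^q`). -/
def Gfun (u : E3 → ℝ → E3) (p q : ℝ≥0∞) (z₀ : E3 × ℝ) (R : ℝ) : ℝ :=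
  R ^ (1 - 3 / p.toReal - 2 / q.toReal) *
    (eLpNorm (fun t =>
        (eLpNorm (fun x => bnorm u x t) p (volume.restrict (Metric.ball z₀.1 R))).toReal)
      q (volume.restrict (Ioo (z₀.2 - R ^ 2) z₀.2))).toReal

/-- `m_R = inf_{Q(R)} Γ`. -/
def mR (u : E3 → ℝ → E3) (R : ℝ) : ℝ :=
  sInf ((fun z : E3 × ℝ => Gam u z.1 z.2) '' Qyl (0, 0) R)

/-- `M_R = sup_{Q(R)} Γ`. -/
def MMR (u : E3 → ℝ → E3) (R : ℝ) : ℝ :=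
  sSup ((fun z : E3 × ℝ => Gam u z.1 z.2) '' Qyl (0, 0) R)

/-- `J_R = M_R - m_R`. -/
def JR (u : E3 → ℝ → E3) (R : ℝ) : ℝ := MMR u R - mR u R

/-- the normalized function `h`. -/
def hfun (u : E3 → ℝ → E3) (R : ℝ) (x : E3) (t : ℝ) : ℝ :=
  if -(mR u R) < MMR u R then 2 * (MMR u R - Gam u x t) / JR u R
  else 2 * (Gam u x t - mR u R) / JR u R

/-- oscillation of `Γ` over `Q(z₀,R)`. -/
def oscΓ (u : E3 → ℝ → E3) (z₀ : E3 × ℝ) (R : ℝ) : ℝ :=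
  sSup ((fun z : E3 × ℝ => Gam u z.1 z.2) '' Qyl z₀ R) -
    sInf ((fun z : E3 × ℝ => Gam u z.1 z.2) '' Qyl z₀ R)

/-- The truncated paraboloid `max(0, 1 - |x|²/R²)`, supported in the closed ball of radius `R`. -/
def quadCut (R : ℝ) (x : E3) : ℝ := max 0 (1 - ‖x‖ ^ 2 / R ^ 2)

lemma hasDerivAt_posPart_pow (n : ℕ) (s : ℝ) :
    HasDerivAt (fun s : ℝ => (max 0 s) ^ (n + 2)) ((n + 2 : ℝ) * (max 0 s) ^ (n + 1)) s := by
  rcases lt_trichotomy s 0 with hs | rfl | hs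
  · have h : (fun s : ℝ => (max 0 s) ^ (n + 2)) =ᶠ[nhds s] fun _ => 0 := by
      filter_upwards [gt_mem_nhds hs] with y hy
      simp [max_eq_left hy.le]
    simpa [max_eq_left hs.le] using (hasDerivAt_const s (0 : ℝ)).congr_of_eventuallyEq h
  · have h : HasFDerivAt (fun s : ℝ => (max 0 s) ^ (n + 2)) (0 : ℝ →L[ℝ] ℝ) 0 := by
      refine Asymptotics.IsBigO.hasFDerivAt (n := n + 2) ?_ (by omega)
      refine Asymptotics.IsBigO.of_bound 1 (Filter.Eventually.of_forall fun y => ?_)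
      have : |max 0 y| ≤ |y| := by
        rcases le_total 0 y with hy | hy
        · simp [max_eq_right hy]
        · simp [max_eq_left hy]
      simpa using pow_le_pow_left₀ (abs_nonneg _) this (n + 2)
    have := h.hasDerivAt
    simpa using this
  · have h : (fun s : ℝ => (max 0 s) ^ (n + 2)) =ᶠ[nhds s] fun s => s ^ (n + 2) := by
      filter_upwards [lt_mem_nhds hs] with y hy
      simp [max_eq_right hy.le]
    have := (hasDerivAt_pow (n + 2) s).congr_of_eventuallyEq h
    simpa [max_eq_right hs.le] using this

lemma quadCut_nonneg (R : ℝ) (x : E3) : 0 ≤ quadCut R x := le_max_left _ _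

lemma quadCut_le_one (R : ℝ) (x : E3) : quadCut R x ≤ 1 :=
  max_le zero_le_one (by have : 0 ≤ ‖x‖ ^ 2 / R ^ 2 := by positivity
                         linarith)

lemma continuous_quadCut (R : ℝ) : Continuous (quadCut R) := by
  unfold quadCut; fun_prop

lemma quadCut_eq_zero {R : ℝ} (hR : 0 < R) {x : E3} (hx : x ∉ Metric.ball (0 : E3) R) :
    quadCut R x = 0 := by
  have h : R ≤ ‖x‖ := by simpa using hx
  refine max_eq_left ?_
  rw [sub_nonpos, one_le_div (by positivity)]
  gcongr

lemma quadCut_anti {R : ℝ} {x y : E3} (h : ‖x‖ ≤ ‖y‖) : quadCut R y ≤ quadCut R x := by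
  unfold quadCut
  gcongr

lemma hasCompactSupport_mul_quadCut {R : ℝ} (hR : 0 < R) (f : E3 → ℝ) (n : ℕ) :
    HasCompactSupport (fun x => f x * quadCut R x ^ (n + 1)) := by
  refine HasCompactSupport.intro (isCompact_closedBall (0 : E3) R) fun x hx => ?_
  have : x ∉ Metric.ball (0 : E3) R := fun h => hx (Metric.ball_subset_closedBall h)
  simp [quadCut_eq_zero hR this]

lemma integrable_mul_quadCut {R : ℝ} (hR : 0 < R) {f : E3 → ℝ} (hf : Continuous f) (n : ℕ) :
    Integrable (fun x => f x * quadCut R x ^ (n + 1)) :=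
  (hf.mul ((continuous_quadCut R).pow _)).integrable_of_hasCompactSupport
    (hasCompactSupport_mul_quadCut hR f n)

lemma integral_mul_quadCut {R : ℝ} (hR : 0 < R) (f : E3 → ℝ) (n : ℕ) :
    ∫ x in Metric.ball (0 : E3) R, f x * quadCut R x ^ (n + 1) =
      ∫ x, f x * quadCut R x ^ (n + 1) :=
  setIntegral_eq_integral_of_forall_compl_eq_zero fun x hx => by simp [quadCut_eq_zero hR hx]

lemma integrableOn_ball {f : E3 → ℝ} (hf : Continuous f) (R : ℝ) :
    IntegrableOn f (Metric.ball (0 : E3) R) :=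
  (hf.continuousOn.integrableOn_compact (isCompact_closedBall (0 : E3) R)).mono_set
    Metric.ball_subset_closedBall

lemma hasFDerivAt_quadCut_pow (R : ℝ) (n : ℕ) (x : E3) :
    HasFDerivAt (fun x => quadCut R x ^ (n + 2))
      (((n + 2 : ℝ) * quadCut R x ^ (n + 1)) • (-(2 / R ^ 2)) • innerSL ℝ x) x := by
  have h1 : HasFDerivAt (fun x : E3 => 1 - ‖x‖ ^ 2 / R ^ 2) ((-(2 / R ^ 2)) • innerSL ℝ x) x := by
    have h := ((hasStrictFDerivAt_norm_sq x).hasFDerivAt.mul_const (R ^ 2)⁻¹).const_sub 1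
    simp only [← div_eq_mul_inv] at h
    refine h.congr_fderiv ?_
    ext y
    simp [div_eq_inv_mul]
    ring
  exact (hasDerivAt_posPart_pow n (1 - ‖x‖ ^ 2 / R ^ 2)).comp_hasFDerivAt x h1

lemma pd_quadCut_pow (R : ℝ) (n : ℕ) (i : Fin 3) (x : E3) :
    pd (fun x => quadCut R x ^ (n + 2)) i x =
      -((n + 2 : ℝ) * quadCut R x ^ (n + 1) * (2 * x i / R ^ 2)) := by
  rw [pd, (hasFDerivAt_quadCut_pow R n x).fderiv]
  have h : inner ℝ x (ee i) = x i := by simp [ee, EuclideanSpace.inner_single_right]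
  simp only [smul_apply, innerSL_apply_apply, h, smul_eq_mul]
  ring

lemma continuous_pd {f : E3 → ℝ} (hf : ContDiff ℝ 1 f) (i : Fin 3) : Continuous (pd f i) :=
  (hf.continuous_fderiv one_ne_zero).clm_apply continuous_const

/-- Integration by parts against a power of `quadCut`. -/
lemma integral_pd_mul_quadCut {R : ℝ} (hR : 0 < R) {f : E3 → ℝ} (hf : ContDiff ℝ 1 f) (n : ℕ)
    (i : Fin 3) :
    ∫ x in Metric.ball (0 : E3) R, pd f i x * quadCut R x ^ (n + 2) =
      ∫ x in Metric.ball (0 : E3) R,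
        f x * ((n + 2 : ℝ) * (2 * x i / R ^ 2)) * quadCut R x ^ (n + 1) := by
  rw [integral_mul_quadCut hR _ (n + 1), integral_mul_quadCut hR _ n]
  have hc : Continuous fun x : E3 => f x * ((n + 2 : ℝ) * (2 * x i / R ^ 2)) := by
    have := hf.continuous
    fun_prop
  have key : ∀ x : E3, f x * fderiv ℝ (fun x => quadCut R x ^ (n + 2)) x (ee i) =
      -(f x * ((n + 2 : ℝ) * (2 * x i / R ^ 2)) * quadCut R x ^ (n + 1)) := fun x => by
    have := pd_quadCut_pow R n i x
    rw [pd] at this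
    rw [this]; ring
  have h := integral_mul_fderiv_eq_neg_fderiv_mul_of_integrable (μ := volume) (𝕜 := ℝ)
    (f := f) (g := fun x => quadCut R x ^ (n + 2)) (v := ee i)
    (integrable_mul_quadCut hR (continuous_pd hf i) (n + 1))
    (by simp only [key]; exact (integrable_mul_quadCut hR hc n).neg)
    (integrable_mul_quadCut hR hf.continuous (n + 1))
    (fun x _ => hf.differentiable one_ne_zero x)
    (fun x _ => (hasFDerivAt_quadCut_pow R n x).differentiableAt)
  simp only [key, integral_neg] at h
  exact (neg_injective h).symm

lemma norm_sq_eq_coords (x : E3) : ‖x‖ ^ 2 = x 0 ^ 2 + x 1 ^ 2 + x 2 ^ 2 := by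
  simp [EuclideanSpace.norm_sq_eq, Fin.sum_univ_three]

lemma ae_off_axis (s : Set E3) : ∀ᵐ x ∂(volume.restrict s), 0 < x 0 ^ 2 + x 1 ^ 2 := by
  refine ae_restrict_of_ae ?_
  let L : Submodule ℝ E3 := LinearMap.ker (EuclideanSpace.proj (𝕜 := ℝ) (0 : Fin 3)).toLinearMap
  have hL : L ≠ ⊤ := fun h => by
    have : ee 0 ∈ L := h ▸ Submodule.mem_top
    simp [L, ee] at this
  have h0 := Measure.addHaar_submodule (volume : Measure E3) L hL
  filter_upwards [measure_eq_zero_iff_ae_notMem.1 h0] with x hx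
  have : x 0 ≠ 0 := fun h => hx (by simpa [L] using h)
  positivity

lemma hasDerivAt_toward_axis {f : E3 → ℝ} (hf : ContDiff ℝ 1 f) (x : E3) (s : ℝ) :
    HasDerivAt (fun s : ℝ => f (x + (s - 1) • (x 0 • ee 0 + x 1 • ee 1)))
      (x 0 * pd f 0 (x + (s - 1) • (x 0 • ee 0 + x 1 • ee 1)) +
        x 1 * pd f 1 (x + (s - 1) • (x 0 • ee 0 + x 1 • ee 1))) s := by
  have h1 : HasDerivAt (fun s : ℝ => x + (s - 1) • (x 0 • ee 0 + x 1 • ee 1))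
      (x 0 • ee 0 + x 1 • ee 1) s := by
    simpa using (((hasDerivAt_id s).sub_const 1).smul_const (x 0 • ee 0 + x 1 • ee 1)).const_add x
  have h2 := (hf.differentiable one_ne_zero
    (x + (s - 1) • (x 0 • ee 0 + x 1 • ee 1))).hasFDerivAt.comp_hasDerivAt s h1
  refine h2.congr_deriv ?_
  simp [pd]

/-- A function that is nonnegative on the axis and whose radial derivative is `O(r)` is bounded
below by a multiple of `-r²`. -/
lemma lower_bound_near_axis {R M : ℝ} {f γ : E3 → ℝ} (hf : ContDiff ℝ 1 f)
    (hM : ∀ x ∈ Metric.ball (0 : E3) R, |γ x| ≤ M)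
    (h0 : ∀ x ∈ Metric.ball (0 : E3) R, x 0 = 0 → x 1 = 0 → 0 ≤ f x)
    (hrel : ∀ x ∈ Metric.ball (0 : E3) R,
      (x 0 ^ 2 + x 1 ^ 2) * γ x = x 0 * pd f 0 x + x 1 * pd f 1 x)
    {x : E3} (hx : x ∈ Metric.ball (0 : E3) R) : -(M * (x 0 ^ 2 + x 1 ^ 2)) ≤ f x := by
  set p : ℝ → E3 := fun s => x + (s - 1) • (x 0 • ee 0 + x 1 • ee 1) with hp
  have p0 : ∀ s, p s 0 = s * x 0 := fun s => by simp [hp, ee]; ring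
  have p1 : ∀ s, p s 1 = s * x 1 := fun s => by simp [hp, ee]; ring
  have p2 : ∀ s, p s 2 = x 2 := fun s => by simp [hp, ee]
  have hM0 : 0 ≤ M := (abs_nonneg _).trans (hM x hx)
  have hpb : ∀ s ∈ Icc (0 : ℝ) 1, p s ∈ Metric.ball (0 : E3) R := fun s hs => by
    have h : ‖p s‖ ^ 2 ≤ ‖x‖ ^ 2 := by
      rw [norm_sq_eq_coords, norm_sq_eq_coords, p0, p1, p2]
      have : s ^ 2 ≤ 1 := by nlinarith [hs.1, hs.2]
      nlinarith [mul_nonneg (sub_nonneg.2 this) (add_nonneg (sq_nonneg (x 0)) (sq_nonneg (x 1)))]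
    have h' : ‖p s‖ ≤ ‖x‖ := abs_le_of_sq_le_sq' h (norm_nonneg _) |>.2
    simp only [mem_ball_zero_iff] at hx ⊢
    exact h'.trans_lt hx
  have hd : ∀ s, HasDerivAt (fun s => f (p s) + M * (x 0 ^ 2 + x 1 ^ 2) * s)
      (x 0 * pd f 0 (p s) + x 1 * pd f 1 (p s) + M * (x 0 ^ 2 + x 1 ^ 2)) s := fun s => by
    have h := (hasDerivAt_toward_axis hf x s).add
      ((hasDerivAt_id s).const_mul (M * (x 0 ^ 2 + x 1 ^ 2)))
    rw [mul_one] at h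
    exact h
  have hmono : MonotoneOn (fun s => f (p s) + M * (x 0 ^ 2 + x 1 ^ 2) * s) (Icc 0 1) := by
    refine monotoneOn_of_deriv_nonneg (convex_Icc 0 1)
      (fun s _ => (hd s).continuousAt.continuousWithinAt)
      (fun s _ => (hd s).differentiableAt.differentiableWithinAt) fun s hs => ?_
    rw [interior_Icc] at hs
    rw [(hd s).deriv]
    have hb := hpb s (Ioo_subset_Icc_self hs)
    have h := hrel _ hb
    rw [p0, p1] at h
    have h' : x 0 * pd f 0 (p s) + x 1 * pd f 1 (p s) = s * (x 0 ^ 2 + x 1 ^ 2) * γ (p s) := by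
      have := hs.1.ne'
      refine mul_left_cancel₀ this ?_
      linarith
    have h2 : -M ≤ s * γ (p s) := by
      have := hM _ hb
      have h3 : |s * γ (p s)| ≤ M := by
        rw [abs_mul, abs_of_pos hs.1]
        nlinarith [hs.1, hs.2, abs_nonneg (γ (p s))]
      exact (abs_le.1 h3).1
    nlinarith [add_nonneg (sq_nonneg (x 0)) (sq_nonneg (x 1))]
  have h01 := hmono (left_mem_Icc.2 zero_le_one) (right_mem_Icc.2 zero_le_one) zero_le_one
  have hp1 : p 1 = x := by simp [hp]
  have hp0 : 0 ≤ f (p 0) :=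
    h0 _ (hpb 0 (left_mem_Icc.2 zero_le_one)) (by simp [p0]) (by simp [p1])
  simp only [hp1] at h01
  linarith

lemma pd_mul {f g : E3 → ℝ} {x : E3} (hf : DifferentiableAt ℝ f x) (hg : DifferentiableAt ℝ g x)
    (i : Fin 3) : pd (fun y => f y * g y) i x = pd f i x * g x + f x * pd g i x := by
  rw [pd, fderiv_fun_mul hf hg]
  simp [pd]
  ring

lemma hasFDerivAt_coord (i : Fin 3) (x : E3) :
    HasFDerivAt (fun y : E3 => y i) (EuclideanSpace.proj (𝕜 := ℝ) i) x :=
  (EuclideanSpace.proj (𝕜 := ℝ) i).hasFDerivAt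

lemma pd_regularized {δ : ℝ} (hδ : 0 < δ) (i : Fin 3) (hi : i = 0 ∨ i = 1) (x : E3) :
    pd (fun y => y i / (y 0 ^ 2 + y 1 ^ 2 + δ)) i x =
      1 / (x 0 ^ 2 + x 1 ^ 2 + δ) - 2 * x i ^ 2 / (x 0 ^ 2 + x 1 ^ 2 + δ) ^ 2 := by
  have hpos : x 0 ^ 2 + x 1 ^ 2 + δ ≠ 0 := by positivity
  have hden := ((((hasFDerivAt_coord 0 x).pow 2).add ((hasFDerivAt_coord 1 x).pow 2)).add_const δ)
  have h := (hasFDerivAt_coord i x).mul ((hasDerivAt_inv hpos).comp_hasFDerivAt x hden)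
  have e : (fun y : E3 => y i / (y 0 ^ 2 + y 1 ^ 2 + δ)) = (fun y : E3 => y i) *
      (fun y => y⁻¹) ∘ fun y : E3 => ((fun y : E3 => y 0 ^ 2) + fun y : E3 => y 1 ^ 2) y + δ := by
    ext y
    simp [div_eq_mul_inv]
  rw [pd, e, h.fderiv]
  rcases hi with rfl | rfl <;> simp [ee] <;> field_simp <;> ring

lemma contDiff_regularized {δ : ℝ} (hδ : 0 < δ) (i : Fin 3) :
    ContDiff ℝ 1 (fun y : E3 => y i / (y 0 ^ 2 + y 1 ^ 2 + δ)) := by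
  refine ContDiff.div (by fun_prop) (by fun_prop) fun x => ?_
  positivity

lemma abs_mul_quadCut_le {M : ℝ} (R : ℝ) {c : ℝ} (hc : |c| ≤ M) (x : E3) (n : ℕ) :
    |c * quadCut R x ^ n| ≤ M := by
  have h1 : quadCut R x ^ n ≤ 1 := pow_le_one₀ (quadCut_nonneg R x) (quadCut_le_one R x)
  have h0 : 0 ≤ quadCut R x ^ n := pow_nonneg (quadCut_nonneg R x) n
  rw [abs_mul, abs_of_nonneg h0]
  nlinarith [abs_nonneg c]

lemma exists_bound_on_ball {f : E3 → ℝ} (hf : Continuous f) (R : ℝ) :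
    ∃ M, 0 ≤ M ∧ ∀ x ∈ Metric.ball (0 : E3) R, |f x| ≤ M := by
  obtain ⟨M, hM⟩ := (isCompact_closedBall (0 : E3) R).exists_bound_of_continuousOn hf.continuousOn
  exact ⟨max M 0, le_max_right _ _, fun x hx =>
    (hM x (Metric.ball_subset_closedBall hx)).trans (le_max_left _ _)⟩

/-- Testing the singular drift `(2/r) ∂ᵣ` against a power of `quadCut`, with the regularization
`r ↦ r / (r² + δ)` of the radial field. -/
lemma integral_regularized_le {R M δ : ℝ} (hR : 0 < R) (hδ : 0 < δ) {f γ : E3 → ℝ}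
    (hf : ContDiff ℝ 1 f) (hγ : Continuous γ) (hM : ∀ x ∈ Metric.ball (0 : E3) R, |γ x| ≤ M)
    (h0 : ∀ x ∈ Metric.ball (0 : E3) R, x 0 = 0 → x 1 = 0 → 0 ≤ f x)
    (hrel : ∀ x ∈ Metric.ball (0 : E3) R,
      (x 0 ^ 2 + x 1 ^ 2) * γ x = x 0 * pd f 0 x + x 1 * pd f 1 x) (n : ℕ) :
    ∫ x in Metric.ball (0 : E3) R,
      ((x 0 ^ 2 + x 1 ^ 2) / (x 0 ^ 2 + x 1 ^ 2 + δ) * (γ x * quadCut R x ^ (n + 2)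
          - f x * ((n + 2 : ℝ) * (2 / R ^ 2)) * quadCut R x ^ (n + 1))
        - 2 * M * (x 0 ^ 2 + x 1 ^ 2) * δ / (x 0 ^ 2 + x 1 ^ 2 + δ) ^ 2
          * quadCut R x ^ (n + 2)) ≤ 0 := by
  set q : Fin 3 → E3 → ℝ := fun i y => y i / (y 0 ^ 2 + y 1 ^ 2 + δ) with hq
  have hqc : ∀ i, ContDiff ℝ 1 (q i) := contDiff_regularized hδ
  have hfq : ∀ i, ContDiff ℝ 1 fun x => f x * q i x := fun i => hf.mul (hqc i)
  have hden : ∀ x : E3, x 0 ^ 2 + x 1 ^ 2 + δ ≠ 0 := fun x => by positivity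
  have hcr : Continuous fun x : E3 => (x 0 ^ 2 + x 1 ^ 2) / (x 0 ^ 2 + x 1 ^ 2 + δ) :=
    Continuous.div (by fun_prop) (by fun_prop) hden
  have hcS := continuous_quadCut R
  have hfc := hf.continuous
  have hcδ : Continuous fun x : E3 =>
      2 * M * (x 0 ^ 2 + x 1 ^ 2) * δ / (x 0 ^ 2 + x 1 ^ 2 + δ) ^ 2 :=
    Continuous.div (by fun_prop) (by fun_prop) fun x => pow_ne_zero _ (hden x)
  have ibp := fun i => integral_pd_mul_quadCut hR (hfq i) n i
  have i1 : ∀ i, IntegrableOn (fun x => pd (fun x => f x * q i x) i x * quadCut R x ^ (n + 2))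
      (Metric.ball (0 : E3) R) := fun i =>
    integrableOn_ball ((continuous_pd (hfq i) i).mul (by fun_prop)) R
  have i2 : ∀ i, IntegrableOn (fun x => f x * q i x * ((n + 2 : ℝ) * (2 * x i / R ^ 2))
      * quadCut R x ^ (n + 1)) (Metric.ball (0 : E3) R) := fun i => by
    have := (hqc i).continuous
    exact integrableOn_ball (by fun_prop) R
  have i3 : ∀ i, IntegrableOn (fun x => pd (fun x => f x * q i x) i x * quadCut R x ^ (n + 2)
      - f x * q i x * ((n + 2 : ℝ) * (2 * x i / R ^ 2)) * quadCut R x ^ (n + 1))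
      (Metric.ball (0 : E3) R) := fun i => (i1 i).sub (i2 i)
  have hz : ∫ x in Metric.ball (0 : E3) R,
      ((pd (fun x => f x * q 0 x) 0 x * quadCut R x ^ (n + 2)
        - f x * q 0 x * ((n + 2 : ℝ) * (2 * x 0 / R ^ 2)) * quadCut R x ^ (n + 1))
      + (pd (fun x => f x * q 1 x) 1 x * quadCut R x ^ (n + 2)
        - f x * q 1 x * ((n + 2 : ℝ) * (2 * x 1 / R ^ 2)) * quadCut R x ^ (n + 1))) = 0 := by
    rw [integral_add (i3 0) (i3 1), integral_sub (i1 0) (i2 0),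
      integral_sub (i1 1) (i2 1), ibp, ibp]
    ring
  rw [← hz]
  refine setIntegral_mono_on ?_ ((i3 0).add (i3 1))
    measurableSet_ball fun x hx => ?_
  · exact integrableOn_ball (by fun_prop) R
  have hlow := lower_bound_near_axis hf hM h0 hrel hx
  have hpd : ∀ i, i = 0 ∨ i = 1 → pd (fun x => f x * q i x) i x = pd f i x * q i x +
      f x * (1 / (x 0 ^ 2 + x 1 ^ 2 + δ) - 2 * x i ^ 2 / (x 0 ^ 2 + x 1 ^ 2 + δ) ^ 2) := by
    intro i hi
    rw [pd_mul (hf.differentiable one_ne_zero x) ((hqc i).differentiable one_ne_zero x),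
      ← pd_regularized hδ i hi x]
  rw [hpd 0 (Or.inl rfl), hpd 1 (Or.inr rfl)]
  have hr := hrel x hx
  have hd := hden x
  have hdpos : 0 < x 0 ^ 2 + x 1 ^ 2 + δ := by positivity
  have hS : 0 ≤ quadCut R x ^ (n + 2) := pow_nonneg (quadCut_nonneg R x) _
  have key : 0 ≤ (f x + M * (x 0 ^ 2 + x 1 ^ 2)) * (2 * δ / (x 0 ^ 2 + x 1 ^ 2 + δ) ^ 2)
      * quadCut R x ^ (n + 2) :=
    mul_nonneg (mul_nonneg (by linarith) (by positivity)) hS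
  rw [← sub_nonneg]
  refine key.trans_eq ?_
  simp only [hq]
  have hr' : (x 0 ^ 2 + x 1 ^ 2) / (x 0 ^ 2 + x 1 ^ 2 + δ) * γ x =
      (x 0 * pd f 0 x + x 1 * pd f 1 x) / (x 0 ^ 2 + x 1 ^ 2 + δ) := by
    rw [← hr]; ring
  have e : (x 0 ^ 2 + x 1 ^ 2) / (x 0 ^ 2 + x 1 ^ 2 + δ) * (γ x * quadCut R x ^ (n + 2)
          - f x * ((n + 2 : ℝ) * (2 / R ^ 2)) * quadCut R x ^ (n + 1)) =
      (x 0 * pd f 0 x + x 1 * pd f 1 x) / (x 0 ^ 2 + x 1 ^ 2 + δ) * quadCut R x ^ (n + 2) -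
      (x 0 ^ 2 + x 1 ^ 2) / (x 0 ^ 2 + x 1 ^ 2 + δ) *
        (f x * ((n + 2 : ℝ) * (2 / R ^ 2)) * quadCut R x ^ (n + 1)) := by
    rw [mul_sub, ← mul_assoc, hr']
  rw [e]
  field_simp
  ring

lemma tendsto_div_add_inv_nat {r : ℝ} (hr : 0 < r) :
    Filter.Tendsto (fun m : ℕ => r / (r + 1 / ((m : ℝ) + 1))) Filter.atTop (nhds 1) := by
  have h := tendsto_one_div_add_atTop_nhds_zero_nat (𝕜 := ℝ)
  have h' := (tendsto_const_nhds (x := r)).div (h.const_add r) (by simpa using hr.ne')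
  rw [add_zero, div_self hr.ne'] at h'
  exact h'

/-- If `f ≥ 0` on the axis and `γ = (1/r) ∂ᵣ f`, the boundary term on the axis created by
integrating `γ` by parts has a sign. -/
lemma integral_radial_le {R : ℝ} (hR : 0 < R) {f γ : E3 → ℝ}
    (hf : ContDiff ℝ 1 f) (hγ : Continuous γ)
    (h0 : ∀ x ∈ Metric.ball (0 : E3) R, x 0 = 0 → x 1 = 0 → 0 ≤ f x)
    (hrel : ∀ x ∈ Metric.ball (0 : E3) R,
      (x 0 ^ 2 + x 1 ^ 2) * γ x = x 0 * pd f 0 x + x 1 * pd f 1 x) (n : ℕ) :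
    ∫ x in Metric.ball (0 : E3) R, γ x * quadCut R x ^ (n + 2) ≤
      ∫ x in Metric.ball (0 : E3) R,
        f x * ((n + 2 : ℝ) * (2 / R ^ 2)) * quadCut R x ^ (n + 1) := by
  obtain ⟨M, hM0, hM⟩ := exists_bound_on_ball hγ R
  have hcS := continuous_quadCut R
  have hfc := hf.continuous
  set G : E3 → ℝ := fun x => γ x * quadCut R x ^ (n + 2)
    - f x * ((n + 2 : ℝ) * (2 / R ^ 2)) * quadCut R x ^ (n + 1) with hG
  have hGc : Continuous G := by fun_prop
  obtain ⟨B, hB0, hB⟩ := exists_bound_on_ball hGc R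
  have i1 : IntegrableOn (fun x => γ x * quadCut R x ^ (n + 2)) (Metric.ball (0 : E3) R) :=
    integrableOn_ball (by fun_prop) R
  have i2 : IntegrableOn (fun x => f x * ((n + 2 : ℝ) * (2 / R ^ 2)) * quadCut R x ^ (n + 1))
    (Metric.ball (0 : E3) R) := integrableOn_ball (by fun_prop) R
  rw [← sub_nonpos, ← integral_sub i1 i2]
  change ∫ x in Metric.ball (0 : E3) R, G x ≤ 0
  set δ : ℕ → ℝ := fun m => 1 / ((m : ℝ) + 1) with hδ
  have hδpos : ∀ m, 0 < δ m := fun m => by positivity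
  refine le_of_tendsto (tendsto_integral_of_dominated_convergence
    (F := fun m x => (x 0 ^ 2 + x 1 ^ 2) / (x 0 ^ 2 + x 1 ^ 2 + δ m) * G x
        - 2 * M * (x 0 ^ 2 + x 1 ^ 2) * δ m / (x 0 ^ 2 + x 1 ^ 2 + δ m) ^ 2
          * quadCut R x ^ (n + 2)) (fun _ => B + 2 * M) ?_ ?_ ?_ ?_)
    (Filter.Eventually.of_forall fun m =>
      integral_regularized_le hR (hδpos m) hf hγ hM h0 hrel n)
  · intro m
    have hden : ∀ x : E3, x 0 ^ 2 + x 1 ^ 2 + δ m ≠ 0 := fun x => by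
      have := hδpos m; positivity
    refine Continuous.aestronglyMeasurable (Continuous.sub (Continuous.mul ?_ hGc)
      (Continuous.mul ?_ (by fun_prop)))
    · exact Continuous.div (by fun_prop) (by fun_prop) hden
    · exact Continuous.div (by fun_prop) (by fun_prop) fun x => pow_ne_zero _ (hden x)
  · exact integrableOn_ball continuous_const R
  · intro m
    refine (ae_restrict_iff' measurableSet_ball).2 (Filter.Eventually.of_forall fun x hx => ?_)
    have hd := hδpos m
    set r := x 0 ^ 2 + x 1 ^ 2
    have hr : 0 ≤ r := by positivity
    have h1 : |r / (r + δ m) * G x| ≤ B := by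
      have : r / (r + δ m) ≤ 1 := div_le_one_of_le₀ (by linarith) (by positivity)
      have h' : 0 ≤ r / (r + δ m) := by positivity
      rw [abs_mul, abs_of_nonneg h']
      nlinarith [hB x hx, abs_nonneg (G x)]
    have h2 : |2 * M * r * δ m / (r + δ m) ^ 2 * quadCut R x ^ (n + 2)| ≤ 2 * M := by
      refine abs_mul_quadCut_le R ?_ x _
      rw [abs_of_nonneg (by positivity), div_le_iff₀ (by positivity)]
      have : r * δ m ≤ (r + δ m) ^ 2 := by nlinarith
      nlinarith
    exact (abs_sub _ _).trans (add_le_add h1 h2)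
  · filter_upwards [ae_off_axis (Metric.ball (0 : E3) R)] with x hx
    have h1 := tendsto_div_add_inv_nat hx
    have h2 := tendsto_one_div_add_atTop_nhds_zero_nat (𝕜 := ℝ)
    have h3 := (h1.mul_const (G x)).sub (((((h1.mul h1).mul h2).const_mul
      (2 * M / (x 0 ^ 2 + x 1 ^ 2))).mul_const (quadCut R x ^ (n + 2))))
    simp only [one_mul, mul_zero, zero_mul, sub_zero] at h3
    refine h3.congr fun m => ?_
    have := hx.ne'
    have : x 0 ^ 2 + x 1 ^ 2 + 1 / ((m : ℝ) + 1) ≠ 0 := by positivity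
    simp only [hδ]
    congr 2
    generalize 1 / ((m : ℝ) + 1) = d at *
    field_simp

lemma fderiv_apply_eq_sum (f : E3 → ℝ) (z v : E3) : fderiv ℝ f z v = ∑ i, v i * pd f i z := by
  have hv : v = ∑ i, v i • ee i := by
    ext j
    fin_cases j <;> simp [ee, Fin.sum_univ_three]
  conv_lhs => rw [hv]
  simp [pd]

lemma sq_fderiv_apply_le (f : E3 → ℝ) (z v : E3) :
    (fderiv ℝ f z v) ^ 2 ≤ ‖v‖ ^ 2 * ∑ i, pd f i z ^ 2 := by
  rw [fderiv_apply_eq_sum, EuclideanSpace.real_norm_sq_eq]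
  exact Finset.sum_mul_sq_le_sq_mul_sq _ _ _

lemma sq_intervalIntegral_le {g : ℝ → ℝ} (hg : Continuous g) :
    (∫ s in (0 : ℝ)..1, g s) ^ 2 ≤ ∫ s in (0 : ℝ)..1, g s ^ 2 := by
  set m := ∫ s in (0 : ℝ)..1, g s with hm
  have h : 0 ≤ ∫ s in (0 : ℝ)..1, (g s - m) ^ 2 :=
    intervalIntegral.integral_nonneg zero_le_one fun s _ => sq_nonneg _
  have e : ∫ s in (0 : ℝ)..1, (g s - m) ^ 2 = (∫ s in (0 : ℝ)..1, g s ^ 2) - m ^ 2 := by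
    have : ∀ s, (g s - m) ^ 2 = g s ^ 2 - (2 * m * g s - m ^ 2) := fun s => by ring
    simp only [this]
    have i1 : IntervalIntegrable (fun s => g s ^ 2) volume 0 1 :=
      (hg.pow 2).intervalIntegrable _ _
    have i2 : IntervalIntegrable (fun s => 2 * m * g s) volume 0 1 :=
      (hg.const_mul _).intervalIntegrable _ _
    have i3 : IntervalIntegrable (fun s => 2 * m * g s - m ^ 2) volume 0 1 :=
      ((hg.const_mul _).sub continuous_const).intervalIntegrable _ _
    rw [intervalIntegral.integral_sub i1 i3,
      intervalIntegral.integral_sub i2 intervalIntegrable_const,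
      intervalIntegral.integral_const_mul, ← hm]
    simp
    ring
  linarith

/-- The weighted Dirichlet density `|∇f|² w`. -/
def dirDens (f : E3 → ℝ) (R : ℝ) (x : E3) : ℝ := (∑ i, pd f i x ^ 2) * quadCut R x ^ 2

lemma dirDens_nonneg (f : E3 → ℝ) (R : ℝ) (x : E3) : 0 ≤ dirDens f R x :=
  mul_nonneg (Finset.sum_nonneg fun _ _ => sq_nonneg _) (sq_nonneg _)

lemma continuous_dirDens {f : E3 → ℝ} (hf : ContDiff ℝ 1 f) (R : ℝ) : Continuous (dirDens f R) :=
  (continuous_finsetSum _ fun i _ => (continuous_pd hf i).pow 2).mul ((continuous_quadCut R).pow 2)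

lemma integrable_dirDens {R : ℝ} (hR : 0 < R) {f : E3 → ℝ} (hf : ContDiff ℝ 1 f) :
    Integrable (dirDens f R) :=
  integrable_mul_quadCut hR (continuous_finsetSum _ fun i _ => (continuous_pd hf i).pow 2) 1

lemma mul_sq_quadCut_le (R : ℝ) (x y : E3) {s : ℝ} (hs : s ∈ Icc (0 : ℝ) 1) :
    quadCut R x ^ 2 * quadCut R y ^ 2 ≤ quadCut R (y + s • (x - y)) ^ 2 := by
  have hz : ‖y + s • (x - y)‖ ≤ max ‖x‖ ‖y‖ := by
    have : y + s • (x - y) = s • x + (1 - s) • y := by module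
    rw [this]
    refine (norm_add_le _ _).trans ?_
    rw [norm_smul, norm_smul, Real.norm_of_nonneg hs.1, Real.norm_of_nonneg (sub_nonneg.2 hs.2)]
    nlinarith [le_max_left ‖x‖ ‖y‖, le_max_right ‖x‖ ‖y‖, hs.1, hs.2]
  have hx := quadCut_nonneg R x
  have hy := quadCut_nonneg R y
  rw [← mul_pow]
  refine pow_le_pow_left₀ (mul_nonneg hx hy) ?_ 2
  rcases le_total ‖x‖ ‖y‖ with h | h
  · rw [max_eq_right h] at hz
    exact (mul_le_of_le_one_left hy (quadCut_le_one R x)).trans (quadCut_anti hz)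
  · rw [max_eq_left h] at hz
    exact (mul_le_of_le_one_right hx (quadCut_le_one R y)).trans (quadCut_anti hz)

lemma sq_sub_mul_le {R : ℝ} {f : E3 → ℝ} (hf : ContDiff ℝ 1 f) {x y : E3}
    (hx : x ∈ Metric.ball (0 : E3) R) (hy : y ∈ Metric.ball (0 : E3) R) :
    (f x - f y) ^ 2 * (quadCut R x ^ 2 * quadCut R y ^ 2) ≤
      4 * R ^ 2 * ∫ s in Icc (0 : ℝ) 1, dirDens f R (y + s • (x - y)) := by
  have hd : ∀ s : ℝ, HasDerivAt (fun s : ℝ => f (y + s • (x - y)))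
      (fderiv ℝ f (y + s • (x - y)) (x - y)) s := fun s => by
    have h1 : HasDerivAt (fun s : ℝ => y + s • (x - y)) (x - y) s := by
      have h := ((hasDerivAt_id s).smul_const (x - y)).const_add y
      rw [one_smul] at h
      exact h
    exact (hf.differentiable one_ne_zero _).hasFDerivAt.comp_hasDerivAt s h1
  have hgc : Continuous fun s : ℝ => fderiv ℝ f (y + s • (x - y)) (x - y) :=
    ((hf.continuous_fderiv one_ne_zero).comp (by fun_prop)).clm_apply continuous_const
  have hftc : ∫ s in (0 : ℝ)..1, fderiv ℝ f (y + s • (x - y)) (x - y) = f x - f y := by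
    rw [intervalIntegral.integral_eq_sub_of_hasDerivAt (fun s _ => hd s)
      (hgc.intervalIntegrable _ _)]
    simp
  have hcs := sq_intervalIntegral_le hgc
  rw [hftc] at hcs
  have hww : 0 ≤ quadCut R x ^ 2 * quadCut R y ^ 2 := by positivity
  have hxy : ‖x - y‖ ^ 2 ≤ 4 * R ^ 2 := by
    have : ‖x - y‖ ≤ 2 * R := by
      refine (norm_sub_le x y).trans ?_
      simp only [mem_ball_zero_iff] at hx hy
      linarith
    nlinarith [norm_nonneg (x - y)]
  calc (f x - f y) ^ 2 * (quadCut R x ^ 2 * quadCut R y ^ 2)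
      ≤ (∫ s in (0 : ℝ)..1, fderiv ℝ f (y + s • (x - y)) (x - y) ^ 2)
          * (quadCut R x ^ 2 * quadCut R y ^ 2) := by gcongr
    _ = ∫ s in (0 : ℝ)..1, fderiv ℝ f (y + s • (x - y)) (x - y) ^ 2
          * (quadCut R x ^ 2 * quadCut R y ^ 2) := by rw [intervalIntegral.integral_mul_const]
    _ ≤ ∫ s in (0 : ℝ)..1, 4 * R ^ 2 * dirDens f R (y + s • (x - y)) := by
        refine intervalIntegral.integral_mono_on zero_le_one
          (by apply Continuous.intervalIntegrable; fun_prop)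
          (((continuous_dirDens hf R).comp (by fun_prop)).const_mul _ |>.intervalIntegrable _ _)
          fun s hs => ?_
        have h1 := sq_fderiv_apply_le f (y + s • (x - y)) (x - y)
        have h2 := mul_sq_quadCut_le R x y hs
        have h3 : 0 ≤ ∑ i, pd f i (y + s • (x - y)) ^ 2 :=
          Finset.sum_nonneg fun _ _ => sq_nonneg _
        have h4 : fderiv ℝ f (y + s • (x - y)) (x - y) ^ 2 ≤
            4 * R ^ 2 * ∑ i, pd f i (y + s • (x - y)) ^ 2 := h1.trans (by gcongr)
        exact (mul_le_mul h4 h2 hww (by positivity)).trans_eq (by rw [dirDens]; ring)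
    _ = 4 * R ^ 2 * ∫ s in Icc (0 : ℝ) 1, dirDens f R (y + s • (x - y)) := by
        rw [intervalIntegral.integral_const_mul, intervalIntegral.integral_of_le zero_le_one,
          integral_Icc_eq_integral_Ioc]

lemma integral_comp_affine_le {F : E3 → ℝ} (hF : Integrable F) (h0 : ∀ x, 0 ≤ F x) (s : Set E3)
    {a : ℝ} (ha : 1 / 2 ≤ a) (c : E3) :
    ∫ x in s, F (a • x + c) ≤ 8 * ∫ x, F x := by
  have ha0 : a ≠ 0 := by linarith
  have hInt : Integrable fun x => F (a • x + c) := (hF.comp_add_right c).comp_smul ha0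
  have h1 : ∫ x in s, F (a • x + c) ≤ ∫ x, F (a • x + c) :=
    setIntegral_le_integral hInt (Filter.Eventually.of_forall fun x => h0 _)
  refine h1.trans ?_
  rw [Measure.integral_comp_smul volume (fun z => F (z + c)) a, integral_add_right_eq_self,
    smul_eq_mul]
  refine mul_le_mul_of_nonneg_right ?_ (integral_nonneg h0)
  have ha' : 0 < a := by linarith
  rw [finrank_euclideanSpace_fin, abs_of_pos (by positivity)]
  rw [inv_le_comm₀ (by positivity) (by norm_num)]
  have : (1 / 2 : ℝ) ^ 3 ≤ a ^ 3 := pow_le_pow_left₀ (by norm_num) ha 3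
  norm_num at this ⊢
  exact this

lemma integral_prod_segment_le {R : ℝ} {F : E3 → ℝ} (hc : Continuous F)
    (hF : Integrable F) (h0 : ∀ x, 0 ≤ F x) {M : ℝ} (hM : ∀ x, F x ≤ M) {s : ℝ} :
    ∫ p : E3 × E3, F (p.2 + s • (p.1 - p.2))
      ∂((volume.restrict (Metric.ball 0 R)).prod (volume.restrict (Metric.ball 0 R))) ≤
      8 * (∫ x, F x) * volume.real (Metric.ball (0 : E3) R) := by
  have : IsFiniteMeasure (volume.restrict (Metric.ball (0 : E3) R)) :=
    ⟨by rw [Measure.restrict_apply_univ]; exact measure_ball_lt_top⟩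
  have hInt : Integrable (fun p : E3 × E3 => F (p.2 + s • (p.1 - p.2)))
      ((volume.restrict (Metric.ball (0 : E3) R)).prod (volume.restrict (Metric.ball 0 R))) := by
    refine Integrable.of_bound (Continuous.aestronglyMeasurable (hc.comp (by fun_prop))) M
      (Filter.Eventually.of_forall fun p => ?_)
    rw [Real.norm_of_nonneg (h0 _)]
    exact hM _
  have hbd : ∀ a : ℝ, 1 / 2 ≤ a → ∀ c : E3,
      ‖∫ x in Metric.ball (0 : E3) R, F (a • x + c)‖ ≤ 8 * ∫ x, F x := fun a ha c => by
    rw [Real.norm_of_nonneg (integral_nonneg fun _ => h0 _)]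
    exact integral_comp_affine_le hF h0 _ ha c
  rcases le_total (1 / 2) s with hs | hs
  · rw [integral_prod_symm _ hInt]
    refine (Real.le_norm_self _).trans (norm_setIntegral_le_of_norm_le_const
      (measure_ball_lt_top (μ := volume) (x := (0 : E3)) (r := R)) fun y _ => ?_)
    have e : ∀ x : E3, y + s • (x - y) = s • x + (1 - s) • y := fun x => by module
    simp only [e]
    exact hbd s hs _
  · rw [integral_prod _ hInt]
    refine (Real.le_norm_self _).trans (norm_setIntegral_le_of_norm_le_const
      (measure_ball_lt_top (μ := volume) (x := (0 : E3)) (r := R)) fun x _ => ?_)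
    have e : ∀ y : E3, y + s • (x - y) = (1 - s) • y + s • x := fun y => by module
    simp only [e]
    exact hbd (1 - s) (by linarith) _

/-- Weighted Poincaré inequality on a ball, with weight `quadCut ^ 2`. -/
lemma poincare_quadCut {R : ℝ} (hR : 0 < R) {f : E3 → ℝ} (hf : ContDiff ℝ 1 f) :
    2 * (∫ x in Metric.ball (0 : E3) R, quadCut R x ^ 2) *
        (∫ x in Metric.ball (0 : E3) R, f x ^ 2 * quadCut R x ^ 2)
      - 2 * (∫ x in Metric.ball (0 : E3) R, f x * quadCut R x ^ 2) ^ 2 ≤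
      32 * R ^ 2 * volume.real (Metric.ball (0 : E3) R) *
        ∫ x in Metric.ball (0 : E3) R, dirDens f R x := by
  have : IsFiniteMeasure (volume.restrict (Metric.ball (0 : E3) R)) :=
    ⟨by rw [Measure.restrict_apply_univ]; exact measure_ball_lt_top⟩
  set μ := volume.restrict (Metric.ball (0 : E3) R) with hμ
  have hfc := hf.continuous
  have hS := continuous_quadCut R
  have hFc := continuous_dirDens hf R
  have hF := integrable_dirDens hR hf
  have hF0 := dirDens_nonneg f R
  obtain ⟨M, hM⟩ : ∃ M, ∀ x, dirDens f R x ≤ M := by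
    obtain ⟨M, hM0, hM⟩ := exists_bound_on_ball hFc R
    refine ⟨M, fun x => ?_⟩
    by_cases hx : x ∈ Metric.ball (0 : E3) R
    · exact (le_abs_self _).trans (hM x hx)
    · simpa [dirDens, quadCut_eq_zero hR hx] using hM0
  have i0 : Integrable (fun x => quadCut R x ^ 2) μ := integrableOn_ball (by fun_prop) R
  have i1 : Integrable (fun x => f x * quadCut R x ^ 2) μ := integrableOn_ball (by fun_prop) R
  have i2 : Integrable (fun x => f x ^ 2 * quadCut R x ^ 2) μ :=
    integrableOn_ball (by fun_prop) R
  have e : ∀ p : E3 × E3, (f p.1 - f p.2) ^ 2 * (quadCut R p.1 ^ 2 * quadCut R p.2 ^ 2) =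
      ((f p.1 ^ 2 * quadCut R p.1 ^ 2) * quadCut R p.2 ^ 2
        + quadCut R p.1 ^ 2 * (f p.2 ^ 2 * quadCut R p.2 ^ 2))
      - 2 * ((f p.1 * quadCut R p.1 ^ 2) * (f p.2 * quadCut R p.2 ^ 2)) := fun p => by ring
  have j1 : Integrable (fun p : E3 × E3 =>
      (f p.1 ^ 2 * quadCut R p.1 ^ 2) * quadCut R p.2 ^ 2) (μ.prod μ) := i2.mul_prod i0
  have j2 : Integrable (fun p : E3 × E3 =>
      quadCut R p.1 ^ 2 * (f p.2 ^ 2 * quadCut R p.2 ^ 2)) (μ.prod μ) := i0.mul_prod i2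
  have j3 : Integrable (fun p : E3 × E3 =>
      2 * ((f p.1 * quadCut R p.1 ^ 2) * (f p.2 * quadCut R p.2 ^ 2))) (μ.prod μ) :=
    (i1.mul_prod i1).const_mul 2
  have j12 : Integrable (fun p : E3 × E3 => (f p.1 ^ 2 * quadCut R p.1 ^ 2) * quadCut R p.2 ^ 2
        + quadCut R p.1 ^ 2 * (f p.2 ^ 2 * quadCut R p.2 ^ 2)) (μ.prod μ) := j1.add j2
  have hlhs : ∫ p : E3 × E3, (f p.1 - f p.2) ^ 2 * (quadCut R p.1 ^ 2 * quadCut R p.2 ^ 2)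
      ∂(μ.prod μ) = 2 * (∫ x, quadCut R x ^ 2 ∂μ) * (∫ x, f x ^ 2 * quadCut R x ^ 2 ∂μ)
      - 2 * (∫ x, f x * quadCut R x ^ 2 ∂μ) ^ 2 := by
    simp only [e]
    rw [integral_sub j12 j3, integral_add j1 j2, integral_const_mul,
      integral_prod_mul (fun x => f x ^ 2 * quadCut R x ^ 2) (fun x => quadCut R x ^ 2),
      integral_prod_mul (fun x => quadCut R x ^ 2) (fun x => f x ^ 2 * quadCut R x ^ 2),
      integral_prod_mul (fun x => f x * quadCut R x ^ 2) (fun x => f x * quadCut R x ^ 2)]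
    ring
  have hDμ : ∫ x, dirDens f R x ∂μ = ∫ x, dirDens f R x := integral_mul_quadCut hR _ 1
  rw [← hlhs, hDμ]
  have hjoint : Integrable (Function.uncurry fun (p : E3 × E3) (s : ℝ) =>
      dirDens f R (p.2 + s • (p.1 - p.2))) ((μ.prod μ).prod (volume.restrict (Icc (0 : ℝ) 1))) := by
    refine Integrable.of_bound (Continuous.aestronglyMeasurable (hFc.comp (by fun_prop))) M
      (Filter.Eventually.of_forall fun p => ?_)
    change ‖dirDens f R _‖ ≤ M
    rw [Real.norm_of_nonneg (hF0 _)]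
    exact hM _
  have hmem : ∀ᵐ p ∂(μ.prod μ), p ∈ Metric.ball (0 : E3) R ×ˢ Metric.ball (0 : E3) R := by
    rw [hμ, Measure.prod_restrict]
    exact ae_restrict_mem (measurableSet_ball.prod measurableSet_ball)
  calc ∫ p : E3 × E3, (f p.1 - f p.2) ^ 2 * (quadCut R p.1 ^ 2 * quadCut R p.2 ^ 2) ∂(μ.prod μ)
      ≤ ∫ p : E3 × E3, 4 * R ^ 2 * (∫ s in Icc (0 : ℝ) 1,
          dirDens f R (p.2 + s • (p.1 - p.2))) ∂(μ.prod μ) := by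
        refine integral_mono_ae ?_ (hjoint.integral_prod_left.const_mul _) ?_
        · simp only [e]
          exact j12.sub j3
        · filter_upwards [hmem] with p hp
          exact sq_sub_mul_le hf hp.1 hp.2
    _ = 4 * R ^ 2 * ∫ s in Icc (0 : ℝ) 1, ∫ p : E3 × E3,
          dirDens f R (p.2 + s • (p.1 - p.2)) ∂(μ.prod μ) := by
        rw [integral_const_mul, integral_integral_swap hjoint]
    _ ≤ 4 * R ^ 2 * (8 * (∫ x, dirDens f R x) * volume.real (Metric.ball (0 : E3) R)) := by
        refine mul_le_mul_of_nonneg_left ?_ (by positivity)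
        have h := norm_setIntegral_le_of_norm_le_const (μ := volume) (s := Icc (0 : ℝ) 1)
          (f := fun s : ℝ => ∫ p : E3 × E3, dirDens f R (p.2 + s • (p.1 - p.2)) ∂(μ.prod μ))
          (C := 8 * (∫ x, dirDens f R x) * volume.real (Metric.ball (0 : E3) R))
          (by simp) fun s _ => by
            rw [Real.norm_of_nonneg (integral_nonneg fun _ => hF0 _)]
            exact integral_prod_segment_le hFc hF hF0 hM
        simpa using (le_abs_self _).trans h
    _ = _ := by ring

lemma volume_real_ball_eq {R : ℝ} (hR : 0 < R) :
    volume.real (Metric.ball (0 : E3) R) = π * 4 / 3 * R ^ 3 := by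
  rw [measureReal_def, EuclideanSpace.volume_ball_fin_three, ENNReal.toReal_mul,
    ENNReal.toReal_pow, ENNReal.toReal_ofReal hR.le, ENNReal.toReal_ofReal (by positivity)]
  ring

lemma four_mul_pow_le_volume {R : ℝ} (hR : 0 < R) :
    4 * R ^ 3 ≤ volume.real (Metric.ball (0 : E3) R) := by
  rw [volume_real_ball_eq hR]
  gcongr
  linarith [Real.pi_gt_three]

lemma volume_le_five_mul_pow {R : ℝ} (hR : 0 < R) :
    volume.real (Metric.ball (0 : E3) R) ≤ 5 * R ^ 3 := by
  rw [volume_real_ball_eq hR]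
  gcongr
  linarith [Real.pi_lt_d2]

lemma integral_quadCut_sq_le (R : ℝ) :
    ∫ x in Metric.ball (0 : E3) R, quadCut R x ^ 2 ≤ volume.real (Metric.ball (0 : E3) R) := by
  have h : ∫ x in Metric.ball (0 : E3) R, quadCut R x ^ 2 ≤
      ∫ _ in Metric.ball (0 : E3) R, (1 : ℝ) := by
    refine setIntegral_mono (integrableOn_ball (by have := continuous_quadCut R; fun_prop) R)
      (integrableOn_ball continuous_const R) fun x => ?_
    exact pow_le_one₀ (quadCut_nonneg R x) (quadCut_le_one R x)
  simpa using h

lemma volume_le_integral_quadCut_sq {R : ℝ} (hR : 0 < R) :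
    volume.real (Metric.ball (0 : E3) R) ≤ 15 * ∫ x in Metric.ball (0 : E3) R, quadCut R x ^ 2 := by
  have hc := continuous_quadCut R
  have hsub : Metric.ball (0 : E3) (R / 2) ⊆ Metric.ball 0 R := Metric.ball_subset_ball (by linarith)
  have h1 : ∫ x in Metric.ball (0 : E3) (R / 2), quadCut R x ^ 2 ≤
      ∫ x in Metric.ball (0 : E3) R, quadCut R x ^ 2 :=
    setIntegral_mono_set (integrableOn_ball (by fun_prop) R)
      (Filter.Eventually.of_forall fun x => sq_nonneg _) hsub.eventuallyLE
  have h2 : ∫ _ in Metric.ball (0 : E3) (R / 2), (9 / 16 : ℝ) ≤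
      ∫ x in Metric.ball (0 : E3) (R / 2), quadCut R x ^ 2 := by
    refine setIntegral_mono_on (integrableOn_ball continuous_const _)
      (integrableOn_ball (by fun_prop) _) measurableSet_ball fun x hx => ?_
    rw [mem_ball_zero_iff] at hx
    have h3 : ‖x‖ ^ 2 / R ^ 2 ≤ 1 / 4 := by
      rw [div_le_iff₀ (by positivity)]
      nlinarith [norm_nonneg x]
    have h4 : 3 / 4 ≤ quadCut R x := by
      rw [quadCut]
      exact le_max_of_le_right (by linarith)
    nlinarith
  have h5 : ∫ _ in Metric.ball (0 : E3) (R / 2), (9 / 16 : ℝ) =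
      9 / 128 * volume.real (Metric.ball (0 : E3) R) := by
    rw [setIntegral_const, volume_real_ball_eq hR, volume_real_ball_eq (by linarith), smul_eq_mul]
    ring
  have : 0 ≤ volume.real (Metric.ball (0 : E3) R) := measureReal_nonneg
  linarith

lemma contDiff_pd {f : E3 → ℝ} {n m : WithTop ℕ∞} (hf : ContDiff ℝ n f) (h : m + 1 ≤ n)
    (i : Fin 3) : ContDiff ℝ m fun x => pd f i x :=
  (hf.fderiv_right h).clm_apply contDiff_const

lemma continuous_lap {f : E3 → ℝ} (hf : ContDiff ℝ 2 f) : Continuous (lap f) :=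
  continuous_finsetSum _ fun i _ =>
    continuous_pd (contDiff_pd (m := 1) hf (by norm_num [one_add_one_eq_two]) i) i

lemma integral_lap_mul_quadCut {R : ℝ} (hR : 0 < R) {f : E3 → ℝ} (hf : ContDiff ℝ 2 f) (n : ℕ) :
    ∫ x in Metric.ball (0 : E3) R, lap f x * quadCut R x ^ (n + 2) =
      ∫ x in Metric.ball (0 : E3) R,
        ∑ i, pd f i x * ((n + 2 : ℝ) * (2 * x i / R ^ 2)) * quadCut R x ^ (n + 1) := by
  have hd : ∀ i, ContDiff ℝ 1 fun x => pd f i x := fun i =>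
    contDiff_pd hf (by norm_num [one_add_one_eq_two]) i
  have hS := continuous_quadCut R
  have hc := fun i => (hd i).continuous
  have hcc := fun i => continuous_pd (hd i) i
  simp only [lap, Finset.sum_mul]
  rw [integral_finsetSum _ fun i _ => integrableOn_ball (by fun_prop) R,
    integral_finsetSum _ fun i _ => integrableOn_ball (by fun_prop) R]
  exact Finset.sum_congr rfl fun i _ => integral_pd_mul_quadCut hR (hd i) n i

lemma energy_pointwise {a x v : Fin 3 → ℝ} {S R : ℝ} (hS0 : 0 ≤ S) (hS1 : S ≤ 1) :
    -(∑ i, a i * (2 * (2 * x i / R ^ 2)) * S) + (-∑ i, a i ^ 2 + ∑ i, v i * a i) * S ^ 2 ≤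
      -(1 / 2) * ((∑ i, a i ^ 2) * S ^ 2) + 16 * (∑ i, x i ^ 2) / R ^ 4 + ∑ i, v i ^ 2 := by
  have hS2 : S ^ 2 ≤ 1 := pow_le_one₀ hS0 hS1
  have h : ∀ i, -(a i * (2 * (2 * x i / R ^ 2)) * S) + (-(a i ^ 2) + v i * a i) * S ^ 2 ≤
      -(1 / 2) * (a i ^ 2 * S ^ 2) + 16 * x i ^ 2 / R ^ 4 + v i ^ 2 := fun i => by
    have h1 : -(a i * (2 * (2 * x i / R ^ 2)) * S) ≤ 1 / 4 * (a i ^ 2 * S ^ 2)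
        + 16 * x i ^ 2 / R ^ 4 := by
      have e : 16 * x i ^ 2 / R ^ 4 = 16 * (x i / R ^ 2) ^ 2 := by
        rw [div_pow]; ring
      rw [e]
      have e2 : 2 * x i / R ^ 2 = 2 * (x i / R ^ 2) := by ring
      rw [e2]
      nlinarith [sq_nonneg (1 / 2 * (a i * S) + 4 * (x i / R ^ 2))]
    have h2 : v i * a i * S ^ 2 ≤ 1 / 4 * (a i ^ 2 * S ^ 2) + v i ^ 2 := by
      nlinarith [sq_nonneg (1 / 2 * (a i * S) - v i * S), sq_nonneg (v i), sq_nonneg S]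
    nlinarith
  simp only [Fin.sum_univ_three]
  have h0 := h 0
  have h1 := h 1
  have h2 := h 2
  ring_nf at h0 h1 h2 ⊢
  linarith

/-- Energy inequality on a time slice, for the logarithm of the solution. -/
lemma slice_energy_le {R A : ℝ} (hR : 0 < R) (hA : 0 ≤ A) {f γ : E3 → ℝ} {v : E3 → E3}
    (hf : ContDiff ℝ 2 f) (hγ : Continuous γ) (hv : Continuous v)
    (h0 : ∀ x ∈ Metric.ball (0 : E3) R, x 0 = 0 → x 1 = 0 → 0 ≤ f x)
    (h2 : ∀ x ∈ Metric.ball (0 : E3) R, f x ≤ 2)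
    (hrel : ∀ x ∈ Metric.ball (0 : E3) R,
      (x 0 ^ 2 + x 1 ^ 2) * γ x = x 0 * pd f 0 x + x 1 * pd f 1 x)
    (hvA : ∫ x in Metric.ball (0 : E3) R, ‖v x‖ ^ 2 ≤ A * R) :
    ∫ x in Metric.ball (0 : E3) R,
        (-lap f x - ∑ i, pd f i x ^ 2 + ∑ i, v x i * pd f i x + 2 * γ x) * quadCut R x ^ 2 ≤
      -(1 / 2) * (∫ x in Metric.ball (0 : E3) R, dirDens f R x)
        + (32 + A) / R ^ 2 * volume.real (Metric.ball (0 : E3) R) := by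
  have hS := continuous_quadCut R
  have hf1 : ContDiff ℝ 1 f := hf.of_le (by norm_num)
  have hfc := hf.continuous
  have hc := fun i => continuous_pd hf1 i
  have hlc := continuous_lap hf
  have hvi : ∀ i : Fin 3, Continuous fun x => v x i := fun i => by fun_prop
  have hD := continuous_dirDens hf1 R
  have i1 : IntegrableOn (fun x => lap f x * quadCut R x ^ 2) (Metric.ball 0 R) :=
    integrableOn_ball (by fun_prop) R
  have i1' : IntegrableOn (fun x => ∑ i, pd f i x * (2 * (2 * x i / R ^ 2)) * quadCut R x)
      (Metric.ball 0 R) := integrableOn_ball (by fun_prop) R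
  have i2 : IntegrableOn (fun x => (-∑ i, pd f i x ^ 2 + ∑ i, v x i * pd f i x)
      * quadCut R x ^ 2) (Metric.ball 0 R) := integrableOn_ball (by fun_prop) R
  have i3 : IntegrableOn (fun x => γ x * quadCut R x ^ 2) (Metric.ball 0 R) :=
    integrableOn_ball (by fun_prop) R
  have n1 : IntegrableOn (fun x => -(lap f x * quadCut R x ^ 2)) (Metric.ball 0 R) := i1.neg
  have n1' : IntegrableOn (fun x => -(∑ i, pd f i x * (2 * (2 * x i / R ^ 2)) * quadCut R x))
      (Metric.ball 0 R) := i1'.neg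
  have i4 : IntegrableOn (fun x => ‖v x‖ ^ 2) (Metric.ball 0 R) :=
    integrableOn_ball (by fun_prop) R
  have i5 : IntegrableOn (dirDens f R) (Metric.ball 0 R) := integrableOn_ball hD R
  have i6 : IntegrableOn (fun _ : E3 => 16 / R ^ 2) (Metric.ball 0 R) :=
    integrableOn_ball continuous_const R
  have i7 : IntegrableOn (fun x => -(1 / 2) * dirDens f R x + 16 / R ^ 2) (Metric.ball 0 R) :=
    (i5.const_mul _).add i6
  have i8 : IntegrableOn (fun x => -(lap f x * quadCut R x ^ 2)
      + (-∑ i, pd f i x ^ 2 + ∑ i, v x i * pd f i x) * quadCut R x ^ 2) (Metric.ball 0 R) :=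
    n1.add i2
  have i9 : IntegrableOn (fun x => -(∑ i, pd f i x * (2 * (2 * x i / R ^ 2)) * quadCut R x)
      + (-∑ i, pd f i x ^ 2 + ∑ i, v x i * pd f i x) * quadCut R x ^ 2) (Metric.ball 0 R) :=
    n1'.add i2
  have e1 : ∫ x in Metric.ball (0 : E3) R,
        (-lap f x - ∑ i, pd f i x ^ 2 + ∑ i, v x i * pd f i x + 2 * γ x) * quadCut R x ^ 2 =
      ∫ x in Metric.ball (0 : E3) R, ((-(lap f x * quadCut R x ^ 2)
      + (-∑ i, pd f i x ^ 2 + ∑ i, v x i * pd f i x) * quadCut R x ^ 2)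
      + 2 * (γ x * quadCut R x ^ 2)) := integral_congr_ae (.of_forall fun x => by ring)
  have hlap := integral_lap_mul_quadCut hR hf 0
  simp only [Nat.cast_zero, zero_add, pow_one] at hlap
  have e2 : ∫ x in Metric.ball (0 : E3) R, (-(lap f x * quadCut R x ^ 2)
      + (-∑ i, pd f i x ^ 2 + ∑ i, v x i * pd f i x) * quadCut R x ^ 2) =
      ∫ x in Metric.ball (0 : E3) R, (-(∑ i, pd f i x * (2 * (2 * x i / R ^ 2)) * quadCut R x)
      + (-∑ i, pd f i x ^ 2 + ∑ i, v x i * pd f i x) * quadCut R x ^ 2) := by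
    rw [integral_add n1 i2, integral_add n1' i2, integral_neg, integral_neg, hlap]
  have e3 : ∫ x in Metric.ball (0 : E3) R,
      (-(∑ i, pd f i x * (2 * (2 * x i / R ^ 2)) * quadCut R x)
      + (-∑ i, pd f i x ^ 2 + ∑ i, v x i * pd f i x) * quadCut R x ^ 2) ≤
      ∫ x in Metric.ball (0 : E3) R, (-(1 / 2) * dirDens f R x + 16 / R ^ 2 + ‖v x‖ ^ 2) := by
    refine setIntegral_mono_on i9 (i7.add i4) measurableSet_ball fun x hx => ?_
    have h := energy_pointwise (a := fun i => pd f i x) (x := fun i => x i) (v := fun i => v x i)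
      (R := R) (quadCut_nonneg R x) (quadCut_le_one R x)
    refine h.trans ?_
    rw [← EuclideanSpace.real_norm_sq_eq, ← EuclideanSpace.real_norm_sq_eq, dirDens]
    have hx2 : ‖x‖ ^ 2 ≤ R ^ 2 :=
      pow_le_pow_left₀ (norm_nonneg _) (mem_ball_zero_iff.1 hx).le 2
    have : 16 * ‖x‖ ^ 2 / R ^ 4 ≤ 16 / R ^ 2 := by
      rw [div_le_div_iff₀ (by positivity) (by positivity)]
      nlinarith [sq_nonneg R]
    linarith
  have e4 : ∫ x in Metric.ball (0 : E3) R, (-(1 / 2) * dirDens f R x + 16 / R ^ 2 + ‖v x‖ ^ 2) =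
      -(1 / 2) * (∫ x in Metric.ball (0 : E3) R, dirDens f R x)
      + 16 / R ^ 2 * volume.real (Metric.ball (0 : E3) R)
      + ∫ x in Metric.ball (0 : E3) R, ‖v x‖ ^ 2 := by
    rw [integral_add i7 i4, integral_add (i5.const_mul _) i6, integral_const_mul,
      setIntegral_const, smul_eq_mul]
    ring
  have hg := integral_radial_le hR hf1 hγ h0 hrel 0
  simp only [Nat.cast_zero, zero_add, pow_one] at hg
  have e5 : ∫ x in Metric.ball (0 : E3) R, f x * (2 * (2 / R ^ 2)) * quadCut R x ≤
      8 / R ^ 2 * volume.real (Metric.ball (0 : E3) R) := by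
    have : ∫ x in Metric.ball (0 : E3) R, f x * (2 * (2 / R ^ 2)) * quadCut R x ≤
        ∫ _ in Metric.ball (0 : E3) R, 8 / R ^ 2 := by
      refine setIntegral_mono_on (integrableOn_ball (by fun_prop) R)
        (integrableOn_ball continuous_const R) measurableSet_ball fun x hx => ?_
      have h3 := h2 x hx
      have h4 := quadCut_nonneg R x
      have h5 := quadCut_le_one R x
      have h6 : f x * quadCut R x ≤ 2 := by nlinarith
      calc f x * (2 * (2 / R ^ 2)) * quadCut R x = (f x * quadCut R x) * (4 / R ^ 2) := by ring
        _ ≤ 2 * (4 / R ^ 2) := by gcongr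
        _ = 8 / R ^ 2 := by ring
    rw [setIntegral_const, smul_eq_mul, mul_comm (volume.real _)] at this
    exact this
  have hb : A * R ≤ A / R ^ 2 * volume.real (Metric.ball (0 : E3) R) := by
    have hb4 := four_mul_pow_le_volume hR
    calc A * R = A / R ^ 2 * R ^ 3 := by field_simp
      _ ≤ A / R ^ 2 * volume.real (Metric.ball (0 : E3) R) := by
        gcongr
        nlinarith [pow_pos hR 3]
  rw [e1, integral_add i8 (i3.const_mul 2), integral_const_mul, e2]
  have e6 : (32 + A) / R ^ 2 * volume.real (Metric.ball (0 : E3) R) =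
      16 / R ^ 2 * volume.real (Metric.ball (0 : E3) R)
      + 2 * (8 / R ^ 2 * volume.real (Metric.ball (0 : E3) R))
      + A / R ^ 2 * volume.real (Metric.ball (0 : E3) R) := by ring
  linarith

lemma pd_mul_coord {f : E3 → ℝ} (hf : ContDiff ℝ 1 f) (i : Fin 3) (x : E3) :
    pd (fun y => f y * y i) i x = f x + pd f i x * x i := by
  rw [pd_mul (hf.differentiable one_ne_zero x) (hasFDerivAt_coord i x).differentiableAt]
  have h : pd (fun y => y i) i x = 1 := by
    rw [pd, (hasFDerivAt_coord i x).fderiv]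
    simp [ee]
  rw [h]
  ring

/-- Second integration by parts, for the Laplacian of `quadCut ^ 3`. -/
lemma neg_eighteen_mul_le_integral_lap {R : ℝ} (hR : 0 < R) {H : E3 → ℝ} (hH : ContDiff ℝ 2 H)
    (h0 : ∀ x ∈ Metric.ball (0 : E3) R, 0 ≤ H x) :
    -(18 / R ^ 2) * (∫ x in Metric.ball (0 : E3) R, H x * quadCut R x ^ 2) ≤
      ∫ x in Metric.ball (0 : E3) R, lap H x * quadCut R x ^ 3 := by
  have hS := continuous_quadCut R
  have hH1 : ContDiff ℝ 1 H := hH.of_le (by norm_num)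
  have hHc := hH.continuous
  have hc := fun i => continuous_pd hH1 i
  have hlap := integral_lap_mul_quadCut hR hH 1
  norm_num at hlap
  rw [hlap, integral_finsetSum _ fun i _ => integrableOn_ball (by fun_prop) R]
  have key : ∀ i, -(6 / R ^ 2) * (∫ x in Metric.ball (0 : E3) R, H x * quadCut R x ^ 2) ≤
      ∫ x in Metric.ball (0 : E3) R, pd H i x * (3 * (2 * x i / R ^ 2)) * quadCut R x ^ 2 := by
    intro i
    have hx : ContDiff ℝ 1 fun y : E3 => H y * y i := hH1.mul (by fun_prop)
    have hp := integral_pd_mul_quadCut hR hx 0 i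
    have hpos : 0 ≤ ∫ x in Metric.ball (0 : E3) R, pd (fun y => H y * y i) i x
        * quadCut R x ^ 2 := by
      norm_num at hp
      rw [hp]
      refine setIntegral_nonneg measurableSet_ball fun x hx => ?_
      have h1 := h0 x hx
      have h2 := quadCut_nonneg R x
      have e : H x * x i * (2 * (2 * x i / R ^ 2)) * quadCut R x =
        H x * quadCut R x * (4 * x i ^ 2 / R ^ 2) := by ring
      rw [e]
      positivity
    have e : ∫ x in Metric.ball (0 : E3) R, pd H i x * (3 * (2 * x i / R ^ 2)) * quadCut R x ^ 2 =
        6 / R ^ 2 * ((∫ x in Metric.ball (0 : E3) R, pd (fun y => H y * y i) i x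
        * quadCut R x ^ 2) - ∫ x in Metric.ball (0 : E3) R, H x * quadCut R x ^ 2) := by
      rw [← integral_sub (integrableOn_ball (by have := continuous_pd hx i; fun_prop) R)
        (integrableOn_ball (by fun_prop) R), ← integral_const_mul]
      refine integral_congr_ae (.of_forall fun x => ?_)
      simp only [pd_mul_coord hH1]
      ring
    rw [e]
    have : 0 ≤ 6 / R ^ 2 := by positivity
    nlinarith
  have e : -(18 / R ^ 2) * (∫ x in Metric.ball (0 : E3) R, H x * quadCut R x ^ 2) =
      ∑ _i : Fin 3, -(6 / R ^ 2) * (∫ x in Metric.ball (0 : E3) R, H x * quadCut R x ^ 2) := by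
    rw [Finset.sum_const, Finset.card_univ, Fintype.card_fin, nsmul_eq_mul]
    push_cast
    ring
  rw [e]
  exact Finset.sum_le_sum fun i _ => key i

lemma integral_transport_quadCut {R : ℝ} (hR : 0 < R) {H : E3 → ℝ} {v : E3 → E3}
    (hH : ContDiff ℝ 1 H) (hv : ContDiff ℝ 1 v)
    (hdiv : ∀ x ∈ Metric.ball (0 : E3) R, ∑ i, pd (fun y => v y i) i x = 0) :
    ∫ x in Metric.ball (0 : E3) R, (∑ i, v x i * pd H i x) * quadCut R x ^ 3 =
      ∫ x in Metric.ball (0 : E3) R, 6 / R ^ 2 * (H x * (∑ i, v x i * x i) * quadCut R x ^ 2) := by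
  have hS := continuous_quadCut R
  have hHc := hH.continuous
  have hvi : ∀ i : Fin 3, ContDiff ℝ 1 fun x => v x i := fun i => by fun_prop
  have hvc := fun i => (hvi i).continuous
  have hc := fun i => continuous_pd hH i
  have hprod : ∀ i : Fin 3, ContDiff ℝ 1 fun x => H x * v x i := fun i => hH.mul (hvi i)
  have hpc := fun i => continuous_pd (hprod i) i
  have e1 : ∫ x in Metric.ball (0 : E3) R, (∑ i, v x i * pd H i x) * quadCut R x ^ 3 =
      ∫ x in Metric.ball (0 : E3) R, ∑ i, pd (fun y => H y * v y i) i x * quadCut R x ^ 3 := by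
    refine setIntegral_congr_fun measurableSet_ball fun x hx => ?_
    simp only
    have hmul : ∀ i, pd (fun y => H y * v y i) i x = H x * pd (fun y => v y i) i x
        + v x i * pd H i x := fun i => by
      rw [pd_mul (hH.differentiable one_ne_zero x) ((hvi i).differentiable one_ne_zero x)]
      ring
    simp only [hmul]
    rw [← Finset.sum_mul, Finset.sum_add_distrib, ← Finset.mul_sum, hdiv x hx]
    ring
  rw [e1, integral_finsetSum _ fun i _ => integrableOn_ball (by have := hpc i; fun_prop) R]
  have e2 : ∀ i : Fin 3, ∫ x in Metric.ball (0 : E3) R, pd (fun y => H y * v y i) i x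
      * quadCut R x ^ 3 = ∫ x in Metric.ball (0 : E3) R,
        6 / R ^ 2 * (H x * (v x i * x i) * quadCut R x ^ 2) := fun i => by
    have h := integral_pd_mul_quadCut hR (hprod i) 1 i
    norm_num at h
    rw [h]
    refine integral_congr_ae (.of_forall fun x => ?_)
    simp only
    ring
  simp only [e2]
  rw [← integral_finsetSum _ fun i _ => integrableOn_ball (by have := hvc i; fun_prop) R]
  refine integral_congr_ae (.of_forall fun x => ?_)
  simp only [Finset.mul_sum, Finset.sum_mul]

/-- Lower bound on a time slice for the growth rate of a supersolution. -/
lemma slice_growth_ge {R A : ℝ} (hR : 0 < R) (hA : 0 ≤ A) {H g : E3 → ℝ} {v : E3 → E3}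
    (hH : ContDiff ℝ 2 H) (hg : Continuous g) (hv : ContDiff ℝ 1 v)
    (hpos : ∀ x ∈ Metric.ball (0 : E3) R, 0 ≤ H x)
    (h0 : ∀ x ∈ Metric.ball (0 : E3) R, x 0 = 0 → x 1 = 0 → 1 ≤ H x)
    (hrel : ∀ x ∈ Metric.ball (0 : E3) R,
      (x 0 ^ 2 + x 1 ^ 2) * g x = x 0 * pd H 0 x + x 1 * pd H 1 x)
    (hdiv : ∀ x ∈ Metric.ball (0 : E3) R, ∑ i, pd (fun y => v y i) i x = 0)
    (hvA : ∫ x in Metric.ball (0 : E3) R, ‖v x‖ ^ 2 ≤ A * R) :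
    (10 * (∫ x in Metric.ball (0 : E3) R, quadCut R x ^ 2)
        - 270 * (1 + A) * ∫ x in Metric.ball (0 : E3) R, H x ^ 2 * quadCut R x ^ 2) / R ^ 2 ≤
      ∫ x in Metric.ball (0 : E3) R,
        (lap H x - ∑ i, v x i * pd H i x - 2 * g x) * quadCut R x ^ 3 := by
  have hS := continuous_quadCut R
  have hH1 : ContDiff ℝ 1 H := hH.of_le (by norm_num)
  have hHc := hH.continuous
  have hvc := hv.continuous
  have hvi : ∀ i : Fin 3, Continuous fun x => v x i := fun i => by fun_prop
  have hc := fun i => continuous_pd hH1 i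
  have hlc := continuous_lap hH
  set W := ∫ x in Metric.ball (0 : E3) R, quadCut R x ^ 2 with hW
  set q := ∫ x in Metric.ball (0 : E3) R, H x ^ 2 * quadCut R x ^ 2 with hq
  set p := ∫ x in Metric.ball (0 : E3) R, H x * quadCut R x ^ 2 with hp
  have iW : IntegrableOn (fun x => quadCut R x ^ 2) (Metric.ball (0 : E3) R) :=
    integrableOn_ball (by fun_prop) R
  have iq : IntegrableOn (fun x => H x ^ 2 * quadCut R x ^ 2) (Metric.ball (0 : E3) R) :=
    integrableOn_ball (by fun_prop) R
  have ip : IntegrableOn (fun x => H x * quadCut R x ^ 2) (Metric.ball (0 : E3) R) :=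
    integrableOn_ball (by fun_prop) R
  have iv : IntegrableOn (fun x => ‖v x‖ ^ 2) (Metric.ball (0 : E3) R) :=
    integrableOn_ball (by fun_prop) R
  have il : IntegrableOn (fun x => lap H x * quadCut R x ^ 3) (Metric.ball (0 : E3) R) :=
    integrableOn_ball (by fun_prop) R
  have it : IntegrableOn (fun x => (∑ i, v x i * pd H i x) * quadCut R x ^ 3)
    (Metric.ball (0 : E3) R) := integrableOn_ball (by fun_prop) R
  have ig : IntegrableOn (fun x => g x * quadCut R x ^ 3) (Metric.ball (0 : E3) R) :=
    integrableOn_ball (by fun_prop) R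
  have ilt : IntegrableOn (fun x => lap H x * quadCut R x ^ 3
    - (∑ i, v x i * pd H i x) * quadCut R x ^ 3) (Metric.ball (0 : E3) R) := il.sub it
  have e1 : ∫ x in Metric.ball (0 : E3) R,
        (lap H x - ∑ i, v x i * pd H i x - 2 * g x) * quadCut R x ^ 3 =
      (∫ x in Metric.ball (0 : E3) R, lap H x * quadCut R x ^ 3)
      - (∫ x in Metric.ball (0 : E3) R, (∑ i, v x i * pd H i x) * quadCut R x ^ 3)
      - 2 * ∫ x in Metric.ball (0 : E3) R, g x * quadCut R x ^ 3 := by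
    rw [← integral_const_mul, ← integral_sub il it, ← integral_sub ilt (ig.const_mul 2)]
    refine integral_congr_ae (.of_forall fun x => ?_)
    simp only
    ring
  have hL := neg_eighteen_mul_le_integral_lap hR hH hpos
  have hT : ∫ x in Metric.ball (0 : E3) R, (∑ i, v x i * pd H i x) * quadCut R x ^ 3 ≤
      (A / (5 * (1 + A)) * R ^ 3 + 45 * (1 + A) * q) / R ^ 2 := by
    rw [integral_transport_quadCut hR hH1 hv hdiv]
    have hle : ∫ x in Metric.ball (0 : E3) R,
        6 / R ^ 2 * (H x * (∑ i, v x i * x i) * quadCut R x ^ 2) ≤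
        ∫ x in Metric.ball (0 : E3) R, (R ^ 2 / (5 * (1 + A)) * ‖v x‖ ^ 2
          + 45 * (1 + A) * (H x ^ 2 * quadCut R x ^ 2)) / R ^ 2 := by
      refine setIntegral_mono_on (integrableOn_ball (by fun_prop) R)
        (integrableOn_ball (by fun_prop) R) measurableSet_ball fun x hx => ?_
      have h1 : ∑ i, v x i * x i ≤ ‖v x‖ * R := by
        have h2 : (∑ i, v x i * x i) ^ 2 ≤ (‖v x‖ * ‖x‖) ^ 2 := by
          rw [mul_pow, EuclideanSpace.real_norm_sq_eq, EuclideanSpace.real_norm_sq_eq]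
          exact Finset.sum_mul_sq_le_sq_mul_sq _ _ _
        have h3 := abs_le_of_sq_le_sq h2 (by positivity)
        have h4 := (mem_ball_zero_iff.1 hx).le
        calc ∑ i, v x i * x i ≤ ‖v x‖ * ‖x‖ := (le_abs_self _).trans h3
          _ ≤ ‖v x‖ * R := by gcongr
      have hH0 := hpos x hx
      have hS0 := quadCut_nonneg R x
      have hS1 := quadCut_le_one R x
      have h5 : H x * (∑ i, v x i * x i) * quadCut R x ^ 2 ≤
          (H x * quadCut R x) * (‖v x‖ * R) := by
        calc H x * (∑ i, v x i * x i) * quadCut R x ^ 2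
            ≤ H x * (‖v x‖ * R) * quadCut R x ^ 2 := by gcongr
          _ = (H x * quadCut R x) * (‖v x‖ * R) * quadCut R x := by ring
          _ ≤ (H x * quadCut R x) * (‖v x‖ * R) * 1 := by gcongr
          _ = _ := mul_one _
      rw [div_mul_eq_mul_div]
      refine div_le_div_of_nonneg_right ?_ (by positivity)
      refine (mul_le_mul_of_nonneg_left h5 (by norm_num)).trans ?_
      rw [← sub_nonneg]
      have e : R ^ 2 / (5 * (1 + A)) * ‖v x‖ ^ 2 + 45 * (1 + A) * (H x ^ 2 * quadCut R x ^ 2)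
          - 6 * ((H x * quadCut R x) * (‖v x‖ * R)) =
          (R * ‖v x‖ - 15 * (1 + A) * (H x * quadCut R x)) ^ 2 / (5 * (1 + A)) := by
        field_simp
        ring
      rw [e]
      positivity
    refine hle.trans ?_
    rw [integral_div, integral_add (iv.const_mul _) (iq.const_mul _), integral_const_mul,
      integral_const_mul]
    refine div_le_div_of_nonneg_right ?_ (by positivity)
    have : R ^ 2 / (5 * (1 + A)) * ∫ x in Metric.ball (0 : E3) R, ‖v x‖ ^ 2 ≤
        R ^ 2 / (5 * (1 + A)) * (A * R) := by gcongr
    have e : R ^ 2 / (5 * (1 + A)) * (A * R) = A / (5 * (1 + A)) * R ^ 3 := by ring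
    rw [e] at this
    gcongr
  have hG : ∫ x in Metric.ball (0 : E3) R, g x * quadCut R x ^ 3 ≤ 6 / R ^ 2 * (p - W) := by
    have hpd : ∀ i x, pd (fun y => H y - 1) i x = pd H i x := fun i x => by
      rw [pd, pd, fderiv_sub_const]
    have h := integral_radial_le hR (f := fun x => H x - 1) (hH1.sub contDiff_const) hg
      (fun x hx a b => sub_nonneg.2 (h0 x hx a b)) (fun x hx => by
        rw [hpd, hpd]; exact hrel x hx) 1
    norm_num at h
    refine h.trans_eq ?_
    rw [hp, hW, ← integral_sub ip iW, ← integral_const_mul]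
    refine integral_congr_ae (.of_forall fun x => ?_)
    simp only
    ring
  have hpY : 30 * p ≤ W + 225 * q := by
    rw [hp, hq, hW, ← integral_const_mul, ← integral_const_mul, ← integral_add iW (iq.const_mul _)]
    refine setIntegral_mono (ip.const_mul _) (iW.add (iq.const_mul _)) fun x => ?_
    simp only
    nlinarith [sq_nonneg ((1 - 15 * H x) * quadCut R x)]
  have hR3 : A / (5 * (1 + A)) * R ^ 3 ≤ W := by
    have h1 := four_mul_pow_le_volume hR
    have h2 := volume_le_integral_quadCut_sq hR
    have h3 : A / (5 * (1 + A)) ≤ 1 / 5 := by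
      rw [div_le_div_iff₀ (by positivity) (by norm_num)]
      linarith
    have h4 : 0 < R ^ 3 := by positivity
    nlinarith
  have hq0 : 0 ≤ q := integral_nonneg fun x => by positivity
  rw [e1]
  have hAq : 0 ≤ A * q := mul_nonneg hA hq0
  have e2 : (10 * W - 270 * (1 + A) * q) / R ^ 2 = 12 / R ^ 2 * W
      + (-(2 * W) - 270 * (1 + A) * q) / R ^ 2 := by ring
  have e3 : -(18 / R ^ 2) * p - (A / (5 * (1 + A)) * R ^ 3 + 45 * (1 + A) * q) / R ^ 2
      - 2 * (6 / R ^ 2 * (p - W)) = 12 / R ^ 2 * W +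
      (-(30 * p) - A / (5 * (1 + A)) * R ^ 3 - 45 * (1 + A) * q) / R ^ 2 := by ring
  have h6 : (-(2 * W) - 270 * (1 + A) * q) / R ^ 2 ≤
      (-(30 * p) - A / (5 * (1 + A)) * R ^ 3 - 45 * (1 + A) * q) / R ^ 2 := by
    refine div_le_div_of_nonneg_right ?_ (by positivity)
    linarith
  linarith

lemma hasDerivAt_time {F : E3 → ℝ → ℝ} (hF : ContDiff ℝ 1 fun z : E3 × ℝ => F z.1 z.2)
    (x : E3) (s : ℝ) :
    HasDerivAt (fun s => F x s) (fderiv ℝ (fun z : E3 × ℝ => F z.1 z.2) (x, s) (0, 1)) s := by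
  have h1 : HasDerivAt (fun s : ℝ => (x, s)) ((0 : E3), (1 : ℝ)) s :=
    (hasDerivAt_const s x).prodMk (hasDerivAt_id s)
  exact (hF.differentiable one_ne_zero (x, s)).hasFDerivAt.comp_hasDerivAt s h1

/-- Differentiation in time under the integral over a ball. -/
lemma hasDerivAt_integral_ball {F : E3 → ℝ → ℝ} {R : ℝ}
    (hF : ContDiff ℝ 1 fun z : E3 × ℝ => F z.1 z.2) {w : E3 → ℝ} (hw : Continuous w) (t : ℝ) :
    HasDerivAt (fun s => ∫ x in Metric.ball (0 : E3) R, F x s * w x)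
      (∫ x in Metric.ball (0 : E3) R, deriv (fun s => F x s) t * w x) t := by
  have hd := hasDerivAt_time hF
  have hG : Continuous fun z : E3 × ℝ => fderiv ℝ (fun z : E3 × ℝ => F z.1 z.2) z (0, 1) :=
    (hF.continuous_fderiv one_ne_zero).clm_apply continuous_const
  have hG2 : Continuous fun z : E3 × ℝ =>
    fderiv ℝ (fun z : E3 × ℝ => F z.1 z.2) z (0, 1) * w z.1 := hG.mul (hw.comp continuous_fst)
  have hFc := hF.continuous
  obtain ⟨M, hM⟩ := ((isCompact_closedBall (0 : E3) R).prod
    (isCompact_Icc (a := t - 1) (b := t + 1))).exists_bound_of_continuousOn hG2.continuousOn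
  simp only [fun x => (hd x t).deriv]
  refine (hasDerivAt_integral_of_dominated_loc_of_deriv_le (μ := volume.restrict (Metric.ball 0 R))
    (F := fun s x => F x s * w x) (bound := fun _ => M)
    (F' := fun s x => fderiv ℝ (fun z : E3 × ℝ => F z.1 z.2) (x, s) (0, 1) * w x)
    (Metric.ball_mem_nhds t one_pos) ?_ ?_ ?_ ?_ ?_ ?_).2
  · refine .of_forall fun s => Continuous.aestronglyMeasurable ?_
    exact (hFc.comp (by fun_prop : Continuous fun x : E3 => (x, s))).mul hw
  · exact integrableOn_ball
      ((hFc.comp (by fun_prop : Continuous fun x : E3 => (x, t))).mul hw) R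
  · refine Continuous.aestronglyMeasurable ?_
    exact (hG.comp (by fun_prop : Continuous fun x : E3 => (x, t))).mul hw
  · filter_upwards [ae_restrict_mem measurableSet_ball] with x hx s hs
    refine hM (x, s) ⟨Metric.ball_subset_closedBall hx, ?_⟩
    rw [Real.ball_eq_Ioo] at hs
    exact ⟨hs.1.le, hs.2.le⟩
  · exact integrableOn_ball continuous_const R
  · exact .of_forall fun x s _ => (hd x s).mul_const _

/-- Differential inequalities forcing an upper bound. -/
lemma le_of_differential_inequalities {R B : ℝ} (hR : 0 < R) (hB : 1 ≤ B)
    {y y' ξ ξ' p : ℝ → ℝ}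
    (hy : ∀ s ∈ Ioo (-R ^ 2) 0, HasDerivAt y (y' s) s)
    (hξ : ∀ s ∈ Ioo (-R ^ 2) 0, HasDerivAt ξ (ξ' s) s)
    (hy1 : ∀ s ∈ Ioo (-R ^ 2) 0, y' s ≤ 481 * B / R ^ 2)
    (hy2 : ∀ s ∈ Ioo (-R ^ 2) 0, 0 ≤ y s → y' s ≤ (481 * B - y s ^ 2 * p s / 17280) / R ^ 2)
    (hξ1 : ∀ s ∈ Ioo (-R ^ 2) 0, (10 - 270 * B * p s) / R ^ 2 ≤ ξ' s)
    (hξ0 : ∀ s ∈ Ioo (-R ^ 2) 0, 0 ≤ ξ s) (hξ3 : ∀ s ∈ Ioo (-R ^ 2) 0, ξ s ≤ 3)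
    {t : ℝ} (ht : -R ^ 2 / 4 ≤ t) (ht0 : t < 0) : y t ≤ 1600000 * B := by
  by_contra! hcon
  have hR2 : 0 < R ^ 2 := by positivity
  set s0 : ℝ := -(11 / 12) * R ^ 2 with hs0
  have hs0t : s0 ≤ t := by linarith
  have hB0 : 0 < B := by linarith
  have hsub : ∀ s ∈ Icc s0 t, s ∈ Ioo (-R ^ 2) 0 := fun s hs =>
    ⟨by linarith [hs.1], by linarith [hs.2]⟩
  have hlow : ∀ s ∈ Icc s0 t, 50000 * B ≤ y s := fun s hs => by
    have h := (convex_Icc s t).image_sub_le_mul_sub_of_deriv_le (f := y) (C := 481 * B / R ^ 2)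
      (fun r hr => (hy r (hsub r ⟨hs.1.trans hr.1, hr.2⟩)).continuousAt.continuousWithinAt)
      (fun r hr => (hy r (hsub r ⟨hs.1.trans (interior_subset hr).1,
        (interior_subset hr).2⟩)).differentiableAt.differentiableWithinAt)
      (fun r hr => by
        have hr' := hsub r ⟨hs.1.trans (interior_subset hr).1, (interior_subset hr).2⟩
        rw [(hy r hr').deriv]
        exact hy1 r hr') s ⟨le_rfl, hs.2⟩ t ⟨hs.2, le_rfl⟩ hs.2
    have h2 : 481 * B / R ^ 2 * (t - s) ≤ 481 * B := by
      rw [div_mul_eq_mul_div, div_le_iff₀ hR2]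
      have := hs.1
      gcongr
      nlinarith
    linarith
  set k : ℝ := 1 / (270 * 17280) with hk
  have hZ : ∀ s ∈ Icc s0 t, HasDerivAt (fun s => (y s)⁻¹ + k / B * ξ s)
      (-y' s / y s ^ 2 + k / B * ξ' s) s := fun s hs => by
    have h1 := hlow s hs
    exact ((hy s (hsub s hs)).inv (by nlinarith)).add ((hξ s (hsub s hs)).const_mul _)
  have h := (convex_Icc s0 t).mul_sub_le_image_sub_of_le_deriv
    (f := fun s => (y s)⁻¹ + k / B * ξ s) (C := 9 * k / B / R ^ 2)
    (fun r hr => (hZ r hr).continuousAt.continuousWithinAt)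
    (fun r hr => (hZ r (interior_subset hr)).differentiableAt.differentiableWithinAt)
    (fun r hr => by
      have hr' := interior_subset hr
      have hr2 := hsub r hr'
      have h1 := hlow r hr'
      have hy0 : 0 < y r := by nlinarith
      rw [(hZ r hr').deriv]
      have h2 : -((481 * B - y r ^ 2 * p r / 17280) / R ^ 2) / y r ^ 2 ≤ -y' r / y r ^ 2 :=
        div_le_div_of_nonneg_right (neg_le_neg (hy2 r hr2 hy0.le)) (by positivity)
      have h3 : k / B * ((10 - 270 * B * p r) / R ^ 2) ≤ k / B * ξ' r :=
        mul_le_mul_of_nonneg_left (hξ1 r hr2) (by positivity)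
      have h4 : -((481 * B - y r ^ 2 * p r / 17280) / R ^ 2) / y r ^ 2
          + k / B * ((10 - 270 * B * p r) / R ^ 2) =
          (10 * k / B - 481 * B / y r ^ 2) / R ^ 2 := by
        rw [hk]
        field_simp
        ring
      have h5 : 481 * B / y r ^ 2 ≤ k / B := by
        rw [div_le_div_iff₀ (by positivity) hB0, hk]
        have : (50000 * B) ^ 2 ≤ y r ^ 2 := pow_le_pow_left₀ (by positivity) h1 2
        nlinarith
      have h6 : 9 * k / B / R ^ 2 ≤ (10 * k / B - 481 * B / y r ^ 2) / R ^ 2 := by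
        refine div_le_div_of_nonneg_right ?_ hR2.le
        have : 9 * k / B = 10 * k / B - k / B := by ring
        linarith
      linarith) s0 ⟨le_rfl, hs0t⟩ t ⟨hs0t, le_rfl⟩ hs0t
  have h1 : 6 * k / B ≤ 9 * k / B / R ^ 2 * (t - s0) := by
    have : 6 * k / B = 9 * k / B / R ^ 2 * (2 / 3 * R ^ 2) := by
      field_simp
      norm_num
    rw [this]
    have hk0 : 0 ≤ 9 * k / B / R ^ 2 := by positivity
    refine mul_le_mul_of_nonneg_left ?_ hk0
    linarith
  have h2 : 0 ≤ (y s0)⁻¹ + k / B * ξ s0 := by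
    have := hlow s0 ⟨le_rfl, hs0t⟩
    have h3 := hξ0 s0 (hsub s0 ⟨le_rfl, hs0t⟩)
    have : 0 ≤ y s0 := by nlinarith
    positivity
  have h3 : k / B * ξ t ≤ k / B * 3 :=
    mul_le_mul_of_nonneg_left (hξ3 t (hsub t ⟨hs0t, le_rfl⟩)) (by positivity)
  have h4 : (y t)⁻¹ < 3 * k / B := by
    refine (inv_strictAnti₀ (by positivity) hcon).trans_le ?_
    rw [inv_eq_one_div, div_le_div_iff₀ (by positivity) hB0, hk]
    nlinarith
  have e1 : 6 * k / B = 6 * (k / B) := by ring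
  have e2 : 3 * k / B = 3 * (k / B) := by ring
  linarith

lemma sq_mul_sq_le_sq_log_add {H y : ℝ} (hH : 0 < H) (hH3 : H ≤ 3) (hy : 0 ≤ y) :
    y ^ 2 * H ^ 2 / 36 - 1 ≤ (-log H - y) ^ 2 := by
  rcases le_total (-log H) (y / 2) with h | h
  · have h1 : (y / 2) ^ 2 ≤ (y + log H) ^ 2 := pow_le_pow_left₀ (by positivity) (by linarith) 2
    have h2 : H ^ 2 ≤ 3 ^ 2 := pow_le_pow_left₀ hH.le hH3 2
    nlinarith [sq_nonneg y]
  · have h1 : H ≤ exp (-(y / 2)) := by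
      rw [← exp_log hH]
      exact exp_le_exp.2 (by linarith)
    have h2 : y * H ≤ 2 := by
      have h3 := add_one_le_exp (y / 2)
      have h4 : exp (-(y / 2)) * exp (y / 2) = 1 := by rw [← exp_add]; simp
      have h5 : 0 < exp (-(y / 2)) := exp_pos _
      nlinarith
    have h6 : (y * H) ^ 2 ≤ 2 ^ 2 := pow_le_pow_left₀ (by positivity) h2 2
    nlinarith [sq_nonneg (-log H - y)]

lemma pd_log {H : E3 → ℝ} (hH : ContDiff ℝ 1 H) (hpos : ∀ x, 0 < H x) (i : Fin 3) (x : E3) :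
    pd (fun y => log (H y)) i x = pd H i x / H x := by
  rw [pd, fderiv.log (hH.differentiable one_ne_zero x) (hpos x).ne']
  simp [pd]
  ring

lemma lap_log {H : E3 → ℝ} (hH : ContDiff ℝ 2 H) (hpos : ∀ x, 0 < H x) (x : E3) :
    lap (fun y => log (H y)) x = lap H x / H x - ∑ i, (pd H i x / H x) ^ 2 := by
  have hH1 : ContDiff ℝ 1 H := hH.of_le (by norm_num)
  have hd : ∀ i, ContDiff ℝ 1 fun x => pd H i x := fun i =>
    contDiff_pd hH (by norm_num [one_add_one_eq_two]) i
  have hH0 := (hpos x).ne'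
  have hinv : ∀ i, pd (fun y => (H y)⁻¹) i x = -pd H i x / H x ^ 2 := fun i => by
    have h : HasFDerivAt (fun y => (H y)⁻¹) ((-(H x ^ 2)⁻¹) • fderiv ℝ H x) x :=
      (hasDerivAt_inv hH0).comp_hasFDerivAt x (hH1.differentiable one_ne_zero x).hasFDerivAt
    rw [pd, h.fderiv]
    simp [pd]
    ring
  simp only [lap, pd_log hH1 hpos, div_eq_mul_inv (pd H _ _)]
  rw [Finset.sum_div, ← Finset.sum_sub_distrib]
  refine Finset.sum_congr rfl fun i _ => ?_
  have hdi : DifferentiableAt ℝ (fun y => (H y)⁻¹) x :=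
    (hH1.differentiable one_ne_zero x).inv hH0
  rw [pd_mul ((hd i).differentiable one_ne_zero x) hdi, hinv]
  field_simp
  ring

/-- The weak Harnack inequality for strictly positive supersolutions, with quadratic cutoff. -/
lemma integral_neg_log_le {R A : ℝ} (hR : 0 < R) (hA : 0 ≤ A) {H g : E3 → ℝ → ℝ} {v : E3 → ℝ → E3}
    (hH : ContDiff ℝ 2 fun z : E3 × ℝ => H z.1 z.2)
    (hg : ∀ s ∈ Ioo (-R ^ 2) 0, Continuous fun x => g x s)
    (hv : ∀ s ∈ Ioo (-R ^ 2) 0, ContDiff ℝ 1 fun x => v x s)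
    (hpos : ∀ x s, 0 < H x s)
    (hle : ∀ s ∈ Ioo (-R ^ 2) 0, ∀ x ∈ Metric.ball (0 : E3) R, H x s ≤ 3)
    (h1 : ∀ s ∈ Ioo (-R ^ 2) 0, ∀ x ∈ Metric.ball (0 : E3) R, x 0 = 0 → x 1 = 0 → 1 ≤ H x s)
    (heq : ∀ s ∈ Ioo (-R ^ 2) 0, ∀ x ∈ Metric.ball (0 : E3) R,
      deriv (fun r => H x r) s + ∑ i, v x s i * pd (fun y => H y s) i x
        - lap (fun y => H y s) x + 2 * g x s = 0)
    (hrel : ∀ s ∈ Ioo (-R ^ 2) 0, ∀ x ∈ Metric.ball (0 : E3) R,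
      (x 0 ^ 2 + x 1 ^ 2) * g x s =
        x 0 * pd (fun y => H y s) 0 x + x 1 * pd (fun y => H y s) 1 x)
    (hdiv : ∀ s ∈ Ioo (-R ^ 2) 0, ∀ x ∈ Metric.ball (0 : E3) R,
      ∑ i, pd (fun y => v y s i) i x = 0)
    (hvA : ∀ s ∈ Ioo (-R ^ 2) 0, ∫ x in Metric.ball (0 : E3) R, ‖v x s‖ ^ 2 ≤ A * R)
    {t : ℝ} (ht : -R ^ 2 / 4 ≤ t) (ht0 : t < 0) :
    -(∫ x in Metric.ball (0 : E3) R, log (H x t) * quadCut R x ^ 2) ≤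
      1600000 * (1 + A) * ∫ x in Metric.ball (0 : E3) R, quadCut R x ^ 2 := by
  have hS := continuous_quadCut R
  set W := ∫ x in Metric.ball (0 : E3) R, quadCut R x ^ 2 with hW
  have hbW := volume_le_integral_quadCut_sq hR
  rw [← hW] at hbW
  have hb4 := four_mul_pow_le_volume hR
  set b := volume.real (Metric.ball (0 : E3) R) with hb
  have hR2 : 0 < R ^ 2 := by positivity
  have hR3 : 0 < R ^ 3 := by positivity
  have hW0 : 0 < W := by linarith
  have hslice : ∀ s : ℝ, ContDiff ℝ 2 fun x => H x s := fun s =>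
    hH.comp (by fun_prop : ContDiff ℝ 2 fun x : E3 => (x, s))
  have hslice1 : ∀ s : ℝ, ContDiff ℝ 1 fun x => H x s := fun s => (hslice s).of_le (by norm_num)
  have hlog : ContDiff ℝ 2 fun z : E3 × ℝ => log (H z.1 z.2) := hH.log fun z => (hpos _ _).ne'
  have hlogs : ∀ s : ℝ, ContDiff ℝ 2 fun x => log (H x s) := fun s =>
    (hslice s).log fun x => (hpos _ _).ne'
  have hlog1 : ContDiff ℝ 1 fun z : E3 × ℝ => log (H z.1 z.2) := hlog.of_le (by norm_num)
  have hH1 : ContDiff ℝ 1 fun z : E3 × ℝ => H z.1 z.2 := hH.of_le (by norm_num)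
  set q : ℝ → ℝ := fun s => ∫ x in Metric.ball (0 : E3) R, H x s ^ 2 * quadCut R x ^ 2 with hq
  set D : ℝ → ℝ := fun s => ∫ x in Metric.ball (0 : E3) R, dirDens (fun y => log (H y s)) R x
    with hD
  set Y : ℝ → ℝ := fun s => ∫ x in Metric.ball (0 : E3) R, log (H x s) * quadCut R x ^ 2 with hY
  set X : ℝ → ℝ := fun s => ∫ x in Metric.ball (0 : E3) R, H x s * quadCut R x ^ 3 with hX
  have hY' : ∀ s, HasDerivAt Y (∫ x in Metric.ball (0 : E3) R,
      deriv (fun r => log (H x r)) s * quadCut R x ^ 2) s := fun s =>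
    hasDerivAt_integral_ball (F := fun x s => log (H x s)) hlog1 (hS.pow 2) s
  have hX' : ∀ s, HasDerivAt X (∫ x in Metric.ball (0 : E3) R,
      deriv (fun r => H x r) s * quadCut R x ^ 3) s := fun s =>
    hasDerivAt_integral_ball hH1 (hS.pow 3) s
  have hD0 : ∀ s, 0 ≤ D s := fun s => integral_nonneg fun x => dirDens_nonneg _ _ _
  have energy : ∀ s ∈ Ioo (-R ^ 2) 0, -(∫ x in Metric.ball (0 : E3) R,
      deriv (fun r => log (H x r)) s * quadCut R x ^ 2) / W ≤
      (480 * (1 + A)) / R ^ 2 - D s / (2 * W) := fun s hs => by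
    have hE := slice_energy_le (f := fun x => log (H x s)) (γ := fun x => g x s / H x s)
      (v := fun x => v x s) hR hA (hlogs s)
      ((hg s hs).div (hslice s).continuous fun x => (hpos x s).ne') (hv s hs).continuous
      (fun x hx a c => log_nonneg (h1 s hs x hx a c))
      (fun x hx => by
        have := log_le_sub_one_of_pos (hpos x s)
        linarith [hle s hs x hx])
      (fun x hx => by
        rw [pd_log (hslice1 s) fun x => hpos x s, pd_log (hslice1 s) fun x => hpos x s]
        rw [mul_div_assoc', hrel s hs x hx]
        ring) (hvA s hs)
    have e : ∫ x in Metric.ball (0 : E3) R, (-lap (fun x => log (H x s)) x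
        - ∑ i, pd (fun x => log (H x s)) i x ^ 2
        + ∑ i, v x s i * pd (fun x => log (H x s)) i x + 2 * (g x s / H x s)) * quadCut R x ^ 2 =
        -∫ x in Metric.ball (0 : E3) R,
          deriv (fun r => log (H x r)) s * quadCut R x ^ 2 := by
      rw [← integral_neg]
      refine setIntegral_congr_fun measurableSet_ball fun x hx => ?_
      simp only
      have hH0 := (hpos x s).ne'
      rw [lap_log (hslice s) fun x => hpos x s]
      simp only [pd_log (hslice1 s) fun x => hpos x s]
      have hdl : deriv (fun r => log (H x r)) s = deriv (fun r => H x r) s / H x s :=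
        deriv.log (hasDerivAt_time hH1 x s).differentiableAt hH0
      have h3 := heq s hs x hx
      have h4 : deriv (fun r => H x r) s = lap (fun y => H y s) x
        - ∑ i, v x s i * pd (fun y => H y s) i x - 2 * g x s := by linarith
      rw [hdl, h4, Fin.sum_univ_three, Fin.sum_univ_three, Fin.sum_univ_three]
      field_simp
      ring
    rw [e] at hE
    rw [div_le_iff₀ hW0]
    have e2 : (480 * (1 + A) / R ^ 2 - D s / (2 * W)) * W = 480 * (1 + A) / R ^ 2 * W
      - D s / 2 := by field_simp
    rw [e2]
    have h5 : (32 + A) / R ^ 2 * b ≤ 480 * (1 + A) / R ^ 2 * W := by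
      rw [div_mul_eq_mul_div, div_mul_eq_mul_div]
      refine div_le_div_of_nonneg_right ?_ hR2.le
      nlinarith
    have : D s = ∫ x in Metric.ball (0 : E3) R, dirDens (fun y => log (H y s)) R x := rfl
    linarith
  have hres := le_of_differential_inequalities (B := 1 + A) (p := fun s => q s / W) hR
    (by linarith) (y := fun s => -Y s / W) (ξ := fun s => X s / W)
    (fun s _ => (hY' s).neg.div_const W) (fun s _ => (hX' s).div_const W)
    (fun s hs => (energy s hs).trans (by
      have h3 : 0 ≤ D s / (2 * W) := div_nonneg (hD0 s) (by positivity)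
      have h4 : 480 * (1 + A) / R ^ 2 ≤ 481 * (1 + A) / R ^ 2 :=
        div_le_div_of_nonneg_right (by linarith) hR2.le
      linarith))
    (fun s hs hy0 => (energy s hs).trans (by
      have hP := poincare_quadCut hR ((hlogs s).of_le (by norm_num : (1 : WithTop ℕ∞) ≤ 2))
      have i2 : IntegrableOn (fun x => log (H x s) ^ 2 * quadCut R x ^ 2) (Metric.ball 0 R) :=
        integrableOn_ball (by have := (hlogs s).continuous; fun_prop) R
      have i1 : IntegrableOn (fun x => log (H x s) * quadCut R x ^ 2) (Metric.ball 0 R) :=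
        integrableOn_ball (by have := (hlogs s).continuous; fun_prop) R
      have i0 : IntegrableOn (fun x => quadCut R x ^ 2) (Metric.ball (0 : E3) R) :=
        integrableOn_ball (by fun_prop) R
      have iq : IntegrableOn (fun x => H x s ^ 2 * quadCut R x ^ 2) (Metric.ball (0 : E3) R) :=
        integrableOn_ball (by have := (hslice s).continuous; fun_prop) R
      set y := -Y s / W with hy
      have hmono : ∫ x in Metric.ball (0 : E3) R, (y ^ 2 / 36 * (H x s ^ 2 * quadCut R x ^ 2)
          - quadCut R x ^ 2) ≤ ∫ x in Metric.ball (0 : E3) R, ((log (H x s) ^ 2 * quadCut R x ^ 2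
          + 2 * y * (log (H x s) * quadCut R x ^ 2)) + y ^ 2 * quadCut R x ^ 2) := by
        refine setIntegral_mono_on ((iq.const_mul _).sub i0)
          ((i2.add (i1.const_mul _)).add (i0.const_mul _)) measurableSet_ball fun x hx => ?_
        have h3 := sq_mul_sq_le_sq_log_add (hpos x s) (hle s hs x hx) hy0
        have h4 := mul_le_mul_of_nonneg_right h3 (sq_nonneg (quadCut R x))
        nlinarith
      have i21 : IntegrableOn (fun x => log (H x s) ^ 2 * quadCut R x ^ 2
          + 2 * y * (log (H x s) * quadCut R x ^ 2)) (Metric.ball 0 R) := i2.add (i1.const_mul _)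
      rw [integral_sub (iq.const_mul _) i0, integral_add i21 (i0.const_mul _),
        integral_add i2 (i1.const_mul _), integral_const_mul, integral_const_mul,
        integral_const_mul] at hmono
      rw [← hW] at hmono hP
      change y ^ 2 / 36 * q s - W ≤ _ + 2 * y * Y s + _ at hmono
      change 2 * W * _ - 2 * Y s ^ 2 ≤ 32 * R ^ 2 * b * D s at hP
      set Q := ∫ x in Metric.ball (0 : E3) R, log (H x s) ^ 2 * quadCut R x ^ 2 with hQ
      have hYy : Y s = -y * W := by rw [hy]; field_simp
      rw [hYy] at hmono hP
      have h5 : 32 * R ^ 2 * b * D s ≤ 32 * R ^ 2 * (15 * W) * D s := by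
        have := hD0 s
        gcongr
      have h6 : W * (Q - y ^ 2 * W) ≤ W * (240 * R ^ 2 * D s) := by nlinarith
      have h7 := le_of_mul_le_mul_left h6 hW0
      have h8 : y ^ 2 / 36 * q s - W ≤ 240 * R ^ 2 * D s := by nlinarith
      have e3 : 480 * (1 + A) / R ^ 2 - D s / (2 * W) =
          (480 * (1 + A) - 240 * R ^ 2 * D s / (480 * W)) / R ^ 2 := by
        field_simp
        ring
      rw [e3]
      refine div_le_div_of_nonneg_right ?_ hR2.le
      have h9 : (y ^ 2 / 36 * q s - W) / (480 * W) ≤ 240 * R ^ 2 * D s / (480 * W) :=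
        div_le_div_of_nonneg_right h8 (by positivity)
      have e4 : (y ^ 2 / 36 * q s - W) / (480 * W) = y ^ 2 * (q s / W) / 17280 - 1 / 480 := by
        field_simp
        ring
      rw [e4] at h9
      linarith))
    (fun s hs => by
      have hG := slice_growth_ge hR hA (hslice s) (hg s hs) (hv s hs) (fun x _ => (hpos x s).le)
        (h1 s hs) (hrel s hs) (hdiv s hs) (hvA s hs)
      have e : ∫ x in Metric.ball (0 : E3) R, (lap (fun x => H x s) x
          - ∑ i, v x s i * pd (fun x => H x s) i x - 2 * g x s) * quadCut R x ^ 3 =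
          ∫ x in Metric.ball (0 : E3) R, deriv (fun r => H x r) s * quadCut R x ^ 3 := by
        refine setIntegral_congr_fun measurableSet_ball fun x hx => ?_
        simp only
        congr 1
        linarith [heq s hs x hx]
      rw [e, ← hW] at hG
      change _ ≤ _ / W
      rw [le_div_iff₀ hW0]
      refine le_trans (le_of_eq ?_) hG
      simp only [hq]
      field_simp)
    (fun s hs => div_nonneg (integral_nonneg fun x =>
      mul_nonneg (hpos x s).le (pow_nonneg (quadCut_nonneg R x) 3)) hW0.le)
    (fun s hs => by
      rw [div_le_iff₀ hW0, hW, ← integral_const_mul]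
      refine setIntegral_mono_on
        (integrableOn_ball (by have := (hslice s).continuous; fun_prop) R)
        (integrableOn_ball (by fun_prop) R) measurableSet_ball fun x hx => ?_
      have h3 := quadCut_nonneg R x
      have h4 : quadCut R x ^ 3 ≤ quadCut R x ^ 2 :=
        pow_le_pow_of_le_one h3 (quadCut_le_one R x) (by norm_num)
      exact mul_le_mul (hle s hs x hx) h4 (by positivity) (by norm_num)) ht ht0
  rw [div_le_iff₀ hW0] at hres
  exact hres

/-- The third component of the vorticity. -/
def vort3 (u : E3 → ℝ → E3) (x : E3) (t : ℝ) : ℝ :=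
  pd (fun y => u y t 1) 0 x - pd (fun y => u y t 0) 1 x

lemma pd_coord (j i : Fin 3) (x : E3) : pd (fun y : E3 => y j) i x = if j = i then 1 else 0 := by
  rw [pd, (hasFDerivAt_coord j x).fderiv]
  simp [ee]

lemma pd_sub {f g : E3 → ℝ} {x : E3} (hf : DifferentiableAt ℝ f x) (hg : DifferentiableAt ℝ g x)
    (i : Fin 3) : pd (fun y => f y - g y) i x = pd f i x - pd g i x := by
  rw [pd, fderiv_fun_sub hf hg]
  simp [pd]

lemma pd_add {f g : E3 → ℝ} {x : E3} (hf : DifferentiableAt ℝ f x) (hg : DifferentiableAt ℝ g x)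
    (i : Fin 3) : pd (fun y => f y + g y) i x = pd f i x + pd g i x := by
  rw [pd, fderiv_fun_add hf hg]
  simp [pd]

lemma pd_congr {f g : E3 → ℝ} {x : E3} (h : f =ᶠ[nhds x] g) (i : Fin 3) : pd f i x = pd g i x := by
  rw [pd, pd, h.fderiv_eq]

lemma pd_eventuallyEq {f g : E3 → ℝ} {x : E3} (h : f =ᶠ[nhds x] g) (i : Fin 3) :
    (fun y => pd f i y) =ᶠ[nhds x] fun y => pd g i y := by
  filter_upwards [h.fderiv (𝕜 := ℝ)] with y hy
  rw [pd, pd, hy]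

lemma lap_congr {f g : E3 → ℝ} {x : E3} (h : f =ᶠ[nhds x] g) : lap f x = lap g x :=
  Finset.sum_congr rfl fun i _ => pd_congr (pd_eventuallyEq h i) i

lemma contDiffAt_pd {f : E3 → ℝ} {x : E3} {n m : WithTop ℕ∞} (hf : ContDiffAt ℝ n f x)
    (h : m + 1 ≤ n) (i : Fin 3) : ContDiffAt ℝ m (fun y => pd f i y) x :=
  (hf.fderiv_right h).clm_apply contDiffAt_const

lemma differentiableAt_coord (i : Fin 3) (x : E3) : DifferentiableAt ℝ (fun y : E3 => y i) x :=
  (hasFDerivAt_coord i x).differentiableAt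

lemma pd_cross {a b : E3 → ℝ} {x : E3} (ha : DifferentiableAt ℝ a x) (hb : DifferentiableAt ℝ b x)
    (i : Fin 3) : pd (fun y => y 0 * b y - y 1 * a y) i x =
      ((if (0 : Fin 3) = i then 1 else 0) * b x + x 0 * pd b i x)
        - ((if (1 : Fin 3) = i then 1 else 0) * a x + x 1 * pd a i x) := by
  have m0 : DifferentiableAt ℝ (fun y : E3 => y 0 * b y) x := (differentiableAt_coord 0 x).mul hb
  have m1 : DifferentiableAt ℝ (fun y : E3 => y 1 * a y) x := (differentiableAt_coord 1 x).mul ha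
  rw [pd_sub m0 m1,
    pd_mul (differentiableAt_coord 0 x) hb, pd_mul (differentiableAt_coord 1 x) ha,
    pd_coord, pd_coord]

lemma lap_cross {a b : E3 → ℝ} {x : E3} (ha : ContDiffAt ℝ 2 a x) (hb : ContDiffAt ℝ 2 b x) :
    lap (fun y => y 0 * b y - y 1 * a y) x =
      x 0 * lap b x - x 1 * lap a x + 2 * (pd b 0 x - pd a 1 x) := by
  have hev : ∀ᶠ y in nhds x, DifferentiableAt ℝ a y ∧ DifferentiableAt ℝ b y := by
    filter_upwards [ha.eventually (by simp), hb.eventually (by simp)] with y h1 h2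
    exact ⟨h1.differentiableAt (by norm_num), h2.differentiableAt (by norm_num)⟩
  have hpd : ∀ i, (fun y => pd (fun y => y 0 * b y - y 1 * a y) i y) =ᶠ[nhds x] fun y =>
      ((if (0 : Fin 3) = i then 1 else 0) * b y + y 0 * pd b i y)
        - ((if (1 : Fin 3) = i then 1 else 0) * a y + y 1 * pd a i y) := fun i => by
    filter_upwards [hev] with y hy
    exact pd_cross hy.1 hy.2 i
  have da := ha.differentiableAt (by norm_num)
  have db := hb.differentiableAt (by norm_num)
  have dpa : ∀ i, DifferentiableAt ℝ (fun y => pd a i y) x := fun i =>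
    (contDiffAt_pd (m := 1) ha (by norm_num [one_add_one_eq_two]) i).differentiableAt (by norm_num)
  have dpb : ∀ i, DifferentiableAt ℝ (fun y => pd b i y) x := fun i =>
    (contDiffAt_pd (m := 1) hb (by norm_num [one_add_one_eq_two]) i).differentiableAt (by norm_num)
  have hcm : ∀ (c : ℝ) {f : E3 → ℝ} (_ : DifferentiableAt ℝ f x) (i : Fin 3),
      pd (fun y => c * f y) i x = c * pd f i x := fun c f hf i => by
    rw [pd, fderiv_const_mul hf]
    simp [pd]
  have key : ∀ i, pd (fun y => pd (fun y => y 0 * b y - y 1 * a y) i y) i x =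
      (2 * ((if (0 : Fin 3) = i then 1 else 0) * pd b i x) + x 0 * pd (fun y => pd b i y) i x)
      - (2 * ((if (1 : Fin 3) = i then 1 else 0) * pd a i x) + x 1 * pd (fun y => pd a i y) i x) :=
    fun i => by
    rw [pd_congr (hpd i)]
    have d1 : DifferentiableAt ℝ (fun y : E3 => (if (0 : Fin 3) = i then (1 : ℝ) else 0) * b y) x :=
      db.const_mul _
    have d2 : DifferentiableAt ℝ (fun y : E3 => (if (1 : Fin 3) = i then (1 : ℝ) else 0) * a y) x :=
      da.const_mul _
    have d3 : DifferentiableAt ℝ (fun y : E3 => y 0 * pd b i y) x :=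
      (differentiableAt_coord 0 x).mul (dpb i)
    have d4 : DifferentiableAt ℝ (fun y : E3 => y 1 * pd a i y) x :=
      (differentiableAt_coord 1 x).mul (dpa i)
    have d13 : DifferentiableAt ℝ
        (fun y : E3 => (if (0 : Fin 3) = i then (1 : ℝ) else 0) * b y + y 0 * pd b i y) x :=
      d1.add d3
    have d24 : DifferentiableAt ℝ
        (fun y : E3 => (if (1 : Fin 3) = i then (1 : ℝ) else 0) * a y + y 1 * pd a i y) x :=
      d2.add d4
    rw [pd_sub d13 d24, pd_add d1 d3, pd_add d2 d4, hcm _ db, hcm _ da,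
      pd_mul (differentiableAt_coord 0 x) (dpb i), pd_mul (differentiableAt_coord 1 x) (dpa i),
      pd_coord, pd_coord]
    ring
  simp only [lap, key, Fin.sum_univ_three, Fin.isValue, Fin.reduceEq, if_true, if_false]
  ring

/-- Rotation of a point about the `x₃` axis. -/
def rotAxis (x : E3) (θ : ℝ) : E3 :=
  !₂[x 0 * cos θ - x 1 * sin θ, x 0 * sin θ + x 1 * cos θ, x 2]

lemma rotAxis_zero (x : E3) : rotAxis x 0 = x := by
  ext i
  fin_cases i <;> simp [rotAxis]

lemma hasDerivAt_rotAxis (x : E3) :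
    HasDerivAt (rotAxis x) ((-x 1) • ee 0 + x 0 • ee 1) 0 := by
  have h : rotAxis x = fun θ => (x 0 * cos θ - x 1 * sin θ) • ee 0
      + (x 0 * sin θ + x 1 * cos θ) • ee 1 + x 2 • ee 2 := by
    funext θ
    ext i
    fin_cases i <;> simp [rotAxis, ee]
  have h0 : HasDerivAt (fun θ => x 0 * cos θ - x 1 * sin θ) (-x 1) 0 :=
    (((hasDerivAt_cos 0).const_mul _).sub ((hasDerivAt_sin 0).const_mul _)).congr_deriv (by simp)
  have h1 : HasDerivAt (fun θ => x 0 * sin θ + x 1 * cos θ) (x 0) 0 :=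
    (((hasDerivAt_sin 0).const_mul _).add ((hasDerivAt_cos 0).const_mul _)).congr_deriv (by simp)
  rw [h]
  exact ((h0.smul_const (ee 0)).add (h1.smul_const (ee 1))).add_const (x 2 • ee 2)

lemma angular_deriv {f : E3 → ℝ} {x : E3} (hf : DifferentiableAt ℝ f x) {c d : ℝ}
    (h : (fun θ => f (rotAxis x θ)) =ᶠ[nhds 0] fun θ => c * cos θ + d * sin θ) :
    -x 1 * pd f 0 x + x 0 * pd f 1 x = d := by
  have hf' : HasFDerivAt f (fderiv ℝ f x) (rotAxis x 0) := by
    rw [rotAxis_zero]; exact hf.hasFDerivAt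
  have h1 : HasDerivAt (fun θ => f (rotAxis x θ)) _ 0 :=
    hf'.comp_hasDerivAt 0 (hasDerivAt_rotAxis x)
  have h2 : HasDerivAt (fun θ => c * cos θ + d * sin θ) d 0 :=
    (((hasDerivAt_cos 0).const_mul c).add ((hasDerivAt_sin 0).const_mul d)).congr_deriv (by simp)
  have h3 := h1.unique (h2.congr_of_eventuallyEq h)
  simpa [pd] using h3

section NavierStokes

variable {u : E3 → ℝ → E3} {P : E3 → ℝ → ℝ} {U : Set (E3 × ℝ)}

lemma axisym_identities (hNS : IsNSQ1 u P U) (hax : IsAxisym u P U) {x : E3} {t : ℝ}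
    (hz : (x, t) ∈ U) (hr : x 0 ^ 2 + x 1 ^ 2 ≠ 0)
    (d0 : DifferentiableAt ℝ (fun y => u y t 0) x) (d1 : DifferentiableAt ℝ (fun y => u y t 1) x)
    (dP : DifferentiableAt ℝ (fun y => P y t) x) :
    -x 1 * pd (fun y => u y t 0) 0 x + x 0 * pd (fun y => u y t 0) 1 x = -u x t 1 ∧
    -x 1 * pd (fun y => u y t 1) 0 x + x 0 * pd (fun y => u y t 1) 1 x = u x t 0 ∧
    -x 1 * pd (fun y => P y t) 0 x + x 0 * pd (fun y => P y t) 1 x = 0 := by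
  obtain ⟨ur, uθ, u3, pp, hform⟩ := hax
  have hU : ∀ᶠ θ in nhds (0 : ℝ), (rotAxis x θ, t) ∈ U := by
    have hc : ContinuousAt (fun θ => (rotAxis x θ, t)) 0 :=
      (hasDerivAt_rotAxis x).continuousAt.prodMk continuousAt_const
    refine hc.eventually (hNS.open_U.mem_nhds ?_)
    change (rotAxis x 0, t) ∈ U
    rw [rotAxis_zero]; exact hz
  have hrot : ∀ θ, rotAxis x θ 0 ^ 2 + rotAxis x θ 1 ^ 2 = x 0 ^ 2 + x 1 ^ 2 := fun θ => by
    simp only [rotAxis, Fin.isValue, PiLp.toLp_apply, Matrix.cons_val_zero, Matrix.cons_val_one]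
    nlinarith [sin_sq_add_cos_sq θ]
  have hx := hform x t hz hr
  have hθ : ∀ᶠ θ in nhds (0 : ℝ), u (rotAxis x θ) t 0 = u x t 0 * cos θ + -u x t 1 * sin θ ∧
      u (rotAxis x θ) t 1 = u x t 1 * cos θ + u x t 0 * sin θ ∧
      P (rotAxis x θ) t = P x t * cos 0 + 0 * sin θ := by
    filter_upwards [hU] with θ h
    have h2 := hform (rotAxis x θ) t h (by rw [hrot]; exact hr)
    rw [hrot] at h2
    have e0 : rotAxis x θ 0 = x 0 * cos θ - x 1 * sin θ := rfl
    have e1 : rotAxis x θ 1 = x 0 * sin θ + x 1 * cos θ := rfl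
    have e2 : rotAxis x θ 2 = x 2 := rfl
    rw [e0, e1, e2] at h2
    obtain ⟨a1, a2, -, a4⟩ := h2
    obtain ⟨b1, b2, -, b4⟩ := hx
    refine ⟨?_, ?_, ?_⟩
    · rw [a1, b1, b2]; ring
    · rw [a2, b1, b2]; ring
    · rw [a4, b4]; simp
  refine ⟨angular_deriv d0 (hθ.mono fun θ h => h.1), angular_deriv d1 (hθ.mono fun θ h => h.2.1), ?_⟩
  have hP : HasDerivAt (fun θ => P (rotAxis x θ) t) 0 0 :=
    (hasDerivAt_const (0 : ℝ) (P x t)).congr_of_eventuallyEq (hθ.mono fun θ h => by simp [h.2.2])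
  have hf' : HasFDerivAt (fun y => P y t) (fderiv ℝ (fun y => P y t) x) (rotAxis x 0) := by
    rw [rotAxis_zero]; exact dP.hasFDerivAt
  have h1 : HasDerivAt (fun θ => P (rotAxis x θ) t) _ 0 :=
    hf'.comp_hasDerivAt 0 (hasDerivAt_rotAxis x)
  simpa [pd] using h1.unique hP

lemma IsNSQ1.contDiffAt_slice (hNS : IsNSQ1 u P U) {x : E3} {t : ℝ} (hz : (x, t) ∈ U) (j : Fin 3) :
    ContDiffAt ℝ (⊤ : ℕ∞) (fun y => u y t j) x := by
  have h := (hNS.smooth_u (x, t) hz).contDiffAt (hNS.open_U.mem_nhds hz)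
  have h2 : ContDiffAt ℝ (⊤ : ℕ∞) (fun y => u y t) x :=
    ContDiffAt.comp x (f := fun y : E3 => (y, t)) h (by fun_prop)
  fun_prop

/-- The equation satisfied by `Γ`, and the relation between `Γ` and the vorticity. -/
lemma gam_identities (hNS : IsNSQ1 u P U) (hax : IsAxisym u P U) {x : E3} {t : ℝ}
    (hz : (x, t) ∈ U) :
    deriv (fun s => Gam u x s) t + ∑ i, u x t i * pd (fun y => Gam u y t) i x
        - lap (fun y => Gam u y t) x + 2 * vort3 u x t = 0 ∧
    (x 0 ^ 2 + x 1 ^ 2) * vort3 u x t =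
      x 0 * pd (fun y => Gam u y t) 0 x + x 1 * pd (fun y => Gam u y t) 1 x := by
  have hs := fun j => hNS.contDiffAt_slice hz j
  have hd := fun j => (hs j).differentiableAt (by simp)
  have h2 : ∀ j, ContDiffAt ℝ 2 (fun y => u y t j) x := fun j =>
    (hs j).of_le (WithTop.coe_le_coe.2 le_top)
  have hPs : DifferentiableAt ℝ (fun y => P y t) x := by
    have h := ((hNS.smooth_P (x, t) hz).contDiffAt (hNS.open_U.mem_nhds hz)).differentiableAt
      (by simp)
    exact DifferentiableAt.comp x (f := fun y : E3 => (y, t)) h (by fun_prop)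
  have ht : ∀ j, DifferentiableAt ℝ (fun s => u x s j) t := fun j => by
    have h := ((hNS.smooth_u (x, t) hz).contDiffAt (hNS.open_U.mem_nhds hz)).differentiableAt
      (by simp)
    have h2 : DifferentiableAt ℝ (fun s => u x s) t :=
      DifferentiableAt.comp t (f := fun s : ℝ => (x, s)) h (by fun_prop)
    fun_prop
  have htG : deriv (fun s => Gam u x s) t =
      x 0 * deriv (fun s => u x s 1) t - x 1 * deriv (fun s => u x s 0) t := by
    have := ((ht 1).hasDerivAt.const_mul (x 0)).sub ((ht 0).hasDerivAt.const_mul (x 1))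
    exact HasDerivAt.deriv this
  have hpd := pd_cross (hd 0) (hd 1)
  have hlap := lap_cross (h2 0) (h2 1)
  have m0 := hNS.momentum x t hz 0
  have m1 := hNS.momentum x t hz 1
  have hP0 : x 0 * pd (fun y => P y t) 1 x = x 1 * pd (fun y => P y t) 0 x := by
    by_cases hr : x 0 ^ 2 + x 1 ^ 2 = 0
    · have a0 : x 0 = 0 := by nlinarith [sq_nonneg (x 0), sq_nonneg (x 1)]
      have a1 : x 1 = 0 := by nlinarith [sq_nonneg (x 0), sq_nonneg (x 1)]
      rw [a0, a1]; ring
    · linarith [(axisym_identities hNS hax hz hr (hd 0) (hd 1) hPs).2.2]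
  simp only [Gam] at htG ⊢
  rw [htG, hlap]
  simp only [hpd, vort3]
  constructor
  · simp only [Fin.sum_univ_three, Fin.isValue, Fin.reduceEq, if_true, if_false] at m0 m1 ⊢
    linear_combination (x 0) * m1 - (x 1) * m0 - hP0
  · simp only [Fin.isValue, Fin.reduceEq, if_true, if_false]
    by_cases hr : x 0 ^ 2 + x 1 ^ 2 = 0
    · have a0 : x 0 = 0 := by nlinarith [sq_nonneg (x 0), sq_nonneg (x 1)]
      have a1 : x 1 = 0 := by nlinarith [sq_nonneg (x 0), sq_nonneg (x 1)]
      rw [a0, a1]; ring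
    · obtain ⟨i0, i1, -⟩ := axisym_identities hNS hax hz hr (hd 0) (hd 1) hPs
      linear_combination -(x 0) * i0 - (x 1) * i1

end NavierStokes

open scoped Manifold ContDiff in
lemma exists_cutoff {K V : Set (E3 × ℝ)} (hK : IsClosed K) (hV : IsOpen V) (hKV : K ⊆ V) :
    ∃ χ : E3 × ℝ → ℝ, ContDiff ℝ (⊤ : ℕ∞) χ ∧ (∀ z ∈ K, ∀ᶠ w in nhds z, χ w = 1) ∧
      (∀ z ∉ V, ∀ᶠ w in nhds z, χ w = 0) ∧ ∀ z, 0 ≤ χ z ∧ χ z ≤ 1 := by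
  obtain ⟨f, h0, h1, hf⟩ := exists_contMDiffMap_zero_one_nhds_of_isClosed (n := ⊤)
    𝓘(ℝ, E3 × ℝ) hV.isClosed_compl hK (disjoint_compl_left_iff_subset.2 hKV)
  rw [Filter.eventually_iff, mem_nhdsSet_iff_forall] at h0 h1
  exact ⟨f, f.contMDiff.contDiff, fun z hz => h1 z hz, fun z hz => h0 z hz, fun z => hf z⟩

lemma contDiff_smul_of_cutoff {E F : Type*} [NormedAddCommGroup E] [NormedSpace ℝ E]
    [NormedAddCommGroup F] [NormedSpace ℝ F] {n : WithTop ℕ∞} {χ : E → ℝ} {f : E → F} {V : Set E}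
    (hχ : ContDiff ℝ n χ) (hf : ∀ z ∈ V, ContDiffAt ℝ n f z)
    (h0 : ∀ z ∉ V, ∀ᶠ w in nhds z, χ w = 0) : ContDiff ℝ n fun z => χ z • f z := by
  rw [contDiff_iff_contDiffAt]
  intro z
  by_cases hz : z ∈ V
  · exact hχ.contDiffAt.smul (hf z hz)
  · exact (contDiffAt_const (c := (0 : F))).congr_of_eventuallyEq
      ((h0 z hz).mono fun w hw => by simp [hw])

lemma pd_affine (f : E3 → ℝ) (c₀ c₁ : ℝ) (i : Fin 3) (x : E3) :
    pd (fun y => c₀ + c₁ * f y) i x = c₁ * pd f i x := by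
  have : (fun y => c₁ * f y) = c₁ • f := rfl
  rw [pd, fderiv_const_add, this, fderiv_const_smul_field]
  simp [pd]

lemma lap_affine (f : E3 → ℝ) (c₀ c₁ : ℝ) (x : E3) :
    lap (fun y => c₀ + c₁ * f y) x = c₁ * lap f x := by
  rw [lap, lap, Finset.mul_sum]
  refine Finset.sum_congr rfl fun i _ => ?_
  have : (fun y => pd (fun y => c₀ + c₁ * f y) i y) = fun y => 0 + c₁ * pd f i y := by
    funext y
    rw [pd_affine, zero_add]
  rw [this, pd_affine]

lemma mem_Qyl {R : ℝ} {x : E3} {t : ℝ} :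
    (x, t) ∈ Qyl (0, 0) R ↔ x ∈ Metric.ball (0 : E3) R ∧ t ∈ Ioo (-R ^ 2) 0 := by
  simp [Qyl]

lemma Qyl_mono {R S : ℝ} (hR : 0 ≤ R) (h : R ≤ S) : Qyl (0, 0) R ⊆ Qyl (0, 0) S := by
  rintro ⟨x, t⟩ hz
  rw [mem_Qyl] at hz ⊢
  exact ⟨Metric.ball_subset_ball h hz.1, by nlinarith [hz.2.1], hz.2.2⟩

lemma isCompact_closure_Qyl (R : ℝ) : IsCompact (closure (Qyl (0, 0) R)) :=
  (Metric.isBounded_ball.prod (Metric.isBounded_Ioo _ _)).isCompact_closure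

section NavierStokes

variable {u : E3 → ℝ → E3} {P : E3 → ℝ → ℝ} {U : Set (E3 × ℝ)} {R : ℝ}

lemma IsNSQ1.closure_subset (hNS : IsNSQ1 u P U) (hR : 0 ≤ R) (hR1 : R ≤ 1) :
    closure (Qyl (0, 0) R) ⊆ U :=
  (closure_mono (Qyl_mono hR hR1)).trans hNS.subset_U

lemma IsNSQ1.contDiffAt_u (hNS : IsNSQ1 u P U) {z : E3 × ℝ} (hz : z ∈ U) :
    ContDiffAt ℝ (⊤ : ℕ∞) (fun z : E3 × ℝ => u z.1 z.2) z :=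
  (hNS.smooth_u z hz).contDiffAt (hNS.open_U.mem_nhds hz)

lemma IsNSQ1.contDiffAt_Gam (hNS : IsNSQ1 u P U) {z : E3 × ℝ} (hz : z ∈ U) :
    ContDiffAt ℝ (⊤ : ℕ∞) (fun z : E3 × ℝ => Gam u z.1 z.2) z := by
  have h := hNS.contDiffAt_u hz
  unfold Gam
  fun_prop

lemma AA_nonneg (u : E3 → ℝ → E3) (z : E3 × ℝ) (hR : 0 ≤ R) : 0 ≤ AA u z R :=
  Real.iSup_nonneg fun _ => Real.iSup_nonneg fun _ =>
    mul_nonneg (inv_nonneg.2 hR) (integral_nonneg fun _ => sq_nonneg _)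

lemma setIntegral_norm_sq_le_AA (hNS : IsNSQ1 u P U) (hR : 0 < R) (hR1 : R ≤ 1) {s : ℝ}
    (hs : s ∈ Ioo (-R ^ 2) 0) :
    ∫ x in Metric.ball (0 : E3) R, ‖u x s‖ ^ 2 ≤ AA u (0, 0) R * R := by
  obtain ⟨B, hB⟩ := (isCompact_closure_Qyl R).exists_bound_of_continuousOn
    (fun z hz => (hNS.contDiffAt_u
      (hNS.closure_subset hR.le hR1 hz)).continuousAt.continuousWithinAt)
  have hbd : ∀ r ∈ Ioo (-R ^ 2) 0, R⁻¹ * ∫ x in Metric.ball (0 : E3) R, ‖u x r‖ ^ 2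
      ≤ R⁻¹ * (B ^ 2 * volume.real (Metric.ball (0 : E3) R)) := fun r hr => by
    refine mul_le_mul_of_nonneg_left ?_ (inv_nonneg.2 hR.le)
    refine (le_abs_self _).trans (Real.norm_eq_abs _ ▸ ?_)
    refine norm_setIntegral_le_of_norm_le_const (μ := volume) measure_ball_lt_top fun x hx => ?_
    rw [norm_pow, norm_norm]
    exact pow_le_pow_left₀ (norm_nonneg _) (hB (x, r) (subset_closure (mem_Qyl.2 ⟨hx, hr⟩))) 2
  have hIoo : Ioo (((0, 0) : E3 × ℝ).2 - R ^ 2) ((0, 0) : E3 × ℝ).2 = Ioo (-R ^ 2) 0 := by simp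
  have hle : R⁻¹ * ∫ x in Metric.ball (0 : E3) R, ‖u x s‖ ^ 2 ≤ AA u (0, 0) R := by
    rw [AA, hIoo]
    have hbdd : BddAbove (range fun r => ⨆ _ : r ∈ Ioo (-R ^ 2) 0,
        R⁻¹ * ∫ x in Metric.ball (0 : E3) R, ‖u x r‖ ^ 2) := by
      refine ⟨R⁻¹ * (B ^ 2 * volume.real (Metric.ball (0 : E3) R)), ?_⟩
      rintro _ ⟨r, rfl⟩
      by_cases hr : r ∈ Ioo (-R ^ 2) 0
      · simpa only [ciSup_pos hr] using hbd r hr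
      · simp only [hr]
        rw [Real.iSup_of_isEmpty]
        positivity
    have := le_ciSup hbdd s
    simpa only [ciSup_pos hs] using this
  rwa [inv_mul_le_iff₀ hR, mul_comm] at hle

/-- The logarithmic estimate for an affine function of `Γ`. -/
lemma integral_neg_log_affine_le (hNS : IsNSQ1 u P U) (hax : IsAxisym u P U) (hR : 0 < R)
    (hR1 : R ≤ 1) {c₀ c₁ ε : ℝ} (hε : 0 < ε) (hε1 : ε ≤ 1) (hc₀ : 1 ≤ c₀)
    (hb : ∀ z ∈ Qyl (0, 0) R, 0 ≤ c₀ + c₁ * Gam u z.1 z.2 ∧ c₀ + c₁ * Gam u z.1 z.2 ≤ 2)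
    {t : ℝ} (ht : -R ^ 2 / 4 ≤ t) (ht0 : t < 0) :
    -(∫ x in Metric.ball (0 : E3) R, log (c₀ + c₁ * Gam u x t + ε) * quadCut R x ^ 2)
      ≤ 1600000 * (1 + AA u (0, 0) R) * ∫ x in Metric.ball (0 : E3) R, quadCut R x ^ 2 := by
  set F : E3 × ℝ → ℝ := fun z => c₀ + c₁ * Gam u z.1 z.2 with hF
  have hFs : ∀ z ∈ U, ContDiffAt ℝ (⊤ : ℕ∞) F z := fun z hz =>
    contDiffAt_const.add (contDiffAt_const.mul (hNS.contDiffAt_Gam hz))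
  have hKU := hNS.closure_subset hR.le hR1
  have hFc : ContinuousOn F (closure (Qyl (0, 0) R)) := fun z hz =>
    (hFs z (hKU hz)).continuousAt.continuousWithinAt
  set V : Set (E3 × ℝ) := U ∩ F ⁻¹' Ioi (-ε) with hVdef
  have hV : IsOpen V := ContinuousOn.isOpen_inter_preimage
    (fun z hz => (hFs z hz).continuousAt.continuousWithinAt) hNS.open_U isOpen_Ioi
  have hKV : closure (Qyl (0, 0) R) ⊆ V := fun z hz => ⟨hKU hz, by
    have h0 : 0 ≤ F z := le_on_closure (f := fun _ => (0 : ℝ)) (fun w hw => (hb w hw).1)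
      continuousOn_const hFc hz
    exact (neg_lt_zero.2 hε).trans_le h0⟩
  obtain ⟨χ, hχ, hχ1, hχ0, hχb⟩ := exists_cutoff isClosed_closure hV hKV
  have hχin : ∀ s ∈ Ioo (-R ^ 2) 0, ∀ x ∈ Metric.ball (0 : E3) R,
      ∀ᶠ w in nhds (x, s), χ w = 1 := fun s hs x hx =>
    hχ1 _ (subset_closure (mem_Qyl.2 ⟨hx, hs⟩))
  have hcx : ∀ (x : E3) (s : ℝ), Filter.Tendsto (fun y => (y, s)) (nhds x) (nhds (x, s)) :=
    fun x s => (continuousAt_id.prodMk continuousAt_const)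
  have hct : ∀ (x : E3) (s : ℝ), Filter.Tendsto (fun r => (x, r)) (nhds s) (nhds (x, s)) :=
    fun x s => (continuousAt_const.prodMk continuousAt_id)
  have hχslice : ∀ s, ContDiff ℝ (⊤ : ℕ∞) fun x => χ (x, s) := fun s =>
    hχ.comp (contDiff_id.prodMk contDiff_const)
  have hχ0s : ∀ s, ∀ x ∉ {x | (x, s) ∈ V}, ∀ᶠ y in nhds x, χ (y, s) = 0 := fun s x hx =>
    (hcx x s).eventually (hχ0 _ hx)
  set H : E3 → ℝ → ℝ := fun x s => 1 + χ (x, s) • (F (x, s) + ε - 1) with hH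
  set g : E3 → ℝ → ℝ := fun x s => χ (x, s) • (c₁ * vort3 u x s) with hg
  set v : E3 → ℝ → E3 := fun x s => χ (x, s) • u x s with hv
  have hHx : ∀ s ∈ Ioo (-R ^ 2) 0, ∀ x ∈ Metric.ball (0 : E3) R,
      (fun y => H y s) =ᶠ[nhds x] fun y => (c₀ + ε) + c₁ * Gam u y s := fun s hs x hx => by
    filter_upwards [(hcx x s).eventually (hχin s hs x hx)] with y hy
    simp only [hH, hy, hF, one_smul]; ring
  have hHt : ∀ s ∈ Ioo (-R ^ 2) 0, ∀ x ∈ Metric.ball (0 : E3) R,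
      (fun r => H x r) =ᶠ[nhds s] fun r => (c₀ + ε) + c₁ * Gam u x r := fun s hs x hx => by
    filter_upwards [(hct x s).eventually (hχin s hs x hx)] with y hy
    simp only [hH, hy, hF, one_smul]; ring
  have hval : ∀ s ∈ Ioo (-R ^ 2) 0, ∀ x ∈ Metric.ball (0 : E3) R,
      H x s = c₀ + c₁ * Gam u x s + ε ∧ g x s = c₁ * vort3 u x s ∧ v x s = u x s :=
    fun s hs x hx => by
    have := (hχin s hs x hx).self_of_nhds
    refine ⟨?_, ?_, ?_⟩
    · simp only [hH, this, hF, one_smul]; ring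
    · simp only [hg, this, one_smul]
    · simp only [hv, this, one_smul]
  have hid : ∀ s ∈ Ioo (-R ^ 2) 0, ∀ x ∈ Metric.ball (0 : E3) R, _ := fun s hs x hx =>
    gam_identities hNS hax (hKU (subset_closure (mem_Qyl.2 ⟨hx, hs⟩)))
  have htm : t ∈ Ioo (-R ^ 2) 0 := ⟨by nlinarith [pow_pos hR 2], ht0⟩
  have main := integral_neg_log_le (H := H) (g := g) (v := v) hR (AA_nonneg u (0, 0) hR.le)
    ?_ ?_ ?_ ?_ ?_ ?_ ?_ ?_ ?_ ?_ ht ht0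
  · have hcongr : ∫ x in Metric.ball (0 : E3) R, log (c₀ + c₁ * Gam u x t + ε) * quadCut R x ^ 2
        = ∫ x in Metric.ball (0 : E3) R, log (H x t) * quadCut R x ^ 2 :=
      setIntegral_congr_fun measurableSet_ball fun x hx => by
        simp only [(hval t htm x hx).1]
    rw [hcongr]
    exact main
  · refine contDiff_const.add (contDiff_smul_of_cutoff (V := V)
      (hχ.of_le (WithTop.coe_le_coe.2 le_top)) (fun z hz => ?_) hχ0)
    exact (((hFs z hz.1).add contDiffAt_const).sub contDiffAt_const).of_le
      (WithTop.coe_le_coe.2 le_top)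
  · intro s _
    refine (contDiff_smul_of_cutoff (n := 0) (V := {x | (x, s) ∈ V})
      ((hχslice s).of_le (by simp)) (fun x hx => ?_) (hχ0s s)).continuous
    have hz : (x, s) ∈ U := hx.1
    have h0 := contDiffAt_pd (m := 0) (hNS.contDiffAt_slice hz 1) (by simp) 0
    have h1 := contDiffAt_pd (m := 0) (hNS.contDiffAt_slice hz 0) (by simp) 1
    exact contDiffAt_const.mul (h0.sub h1)
  · intro s _
    refine contDiff_smul_of_cutoff (V := {x | (x, s) ∈ V})
      ((hχslice s).of_le (WithTop.coe_le_coe.2 le_top)) (fun x hx => ?_) (hχ0s s)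
    exact (ContDiffAt.comp x (f := fun y : E3 => (y, s)) (hNS.contDiffAt_u hx.1)
      (by fun_prop)).of_le (WithTop.coe_le_coe.2 le_top)
  · intro x s
    by_cases hz : (x, s) ∈ V
    · have hpos : -ε < F (x, s) := hz.2
      obtain ⟨h1, h2⟩ := hχb (x, s)
      simp only [hH, smul_eq_mul]
      rcases h1.eq_or_lt with h | h
      · rw [← h]; norm_num
      · nlinarith [mul_pos h (show 0 < F (x, s) + ε by linarith)]
    · have := (hχ0 _ hz).self_of_nhds
      simp only [hH, this]; norm_num
  · intro s hs x hx
    rw [(hval s hs x hx).1]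
    linarith [(hb (x, s) (mem_Qyl.2 ⟨hx, hs⟩)).2]
  · intro s hs x hx h0 h1
    rw [(hval s hs x hx).1]
    simp only [Gam, h0, h1]
    linarith
  · intro s hs x hx
    have hpd : ∀ i, pd (fun y => H y s) i x = c₁ * pd (fun y => Gam u y s) i x := fun i => by
      rw [pd_congr (hHx s hs x hx), pd_affine]
    have hd : deriv (fun r => H x r) s = c₁ * deriv (fun r => Gam u x r) s := by
      rw [(hHt s hs x hx).deriv_eq, deriv_const_add, deriv_const_mul_field]
    rw [lap_congr (hHx s hs x hx), lap_affine, hd, (hval s hs x hx).2.1, (hval s hs x hx).2.2]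
    simp only [hpd]
    have := (hid s hs x hx).1
    rw [Fin.sum_univ_three] at this ⊢
    linear_combination c₁ * this
  · intro s hs x hx
    rw [pd_congr (hHx s hs x hx), pd_congr (hHx s hs x hx), pd_affine, pd_affine,
      (hval s hs x hx).2.1]
    linear_combination c₁ * (hid s hs x hx).2
  · intro s hs x hx
    rw [← hNS.divfree x s (hKU (subset_closure (mem_Qyl.2 ⟨hx, hs⟩)))]
    refine Finset.sum_congr rfl fun i _ => pd_congr ?_ i
    filter_upwards [(hcx x s).eventually (hχin s hs x hx)] with y hy
    simp [hv, hy]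
  · intro s hs
    rw [setIntegral_congr_fun measurableSet_ball
      (fun x hx => by simp only [(hval s hs x hx).2.2] : EqOn _ (fun x => ‖u x s‖ ^ 2) _)]
    exact setIntegral_norm_sq_le_AA hNS hR hR1 hs

end NavierStokes

lemma le_mul_one_sub_of_deriv {κ : ℝ → ℝ} {C : ℝ} (hκ : Differentiable ℝ κ)
    (hd : ∀ s, 0 ≤ s → -C ≤ deriv κ s) (h1 : κ 1 = 0) {s : ℝ} (hs : 0 ≤ s) (hs1 : s ≤ 1) :
    κ s ≤ C * (1 - s) := by
  have := (convex_Ici (0 : ℝ)).mul_sub_le_image_sub_of_le_deriv hκ.continuous.continuousOn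
    hκ.differentiableOn (C := -C)
    (fun x hx => hd x (interior_subset hx)) s hs 1 (mem_Ici.2 zero_le_one) hs1
  rw [h1] at this
  linarith

/-- Passage to the limit `ε → 0` in a bound for the integral of `log (h + ε)`. -/
lemma neg_setIntegral_log_le_of_forall {s : Set E3} (hs : MeasurableSet s) {h w : E3 → ℝ} {B : ℝ}
    (hh : AEMeasurable h (volume.restrict s)) (hb : ∀ x ∈ s, 0 ≤ h x ∧ h x ≤ 2)
    (hw : IntegrableOn w s) (hw0 : ∀ x, 0 ≤ w x)
    (hB0 : 0 ≤ B) (hInt : ∀ ε, 0 < ε → ε ≤ 1 → IntegrableOn (fun x => log (h x + ε) * w x) s)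
    (hB : ∀ ε, 0 < ε → ε ≤ 1 → -∫ x in s, log (h x + ε) * w x ≤ B) :
    -∫ x in s, log (h x) * w x ≤ B := by
  by_cases hi : IntegrableOn (fun x => log (h x) * w x) s
  swap
  · rw [integral_undef hi]; simpa using hB0
  set ε : ℕ → ℝ := fun n => 1 / ((n : ℝ) + 1) with hε
  have hε0 : ∀ n, 0 < ε n := fun n => Nat.one_div_pos_of_nat
  have hε1 : ∀ n, ε n ≤ 1 := fun n => by
    simp only [hε]
    rw [div_le_one (by positivity)]
    linarith [(Nat.cast_nonneg n : (0 : ℝ) ≤ n)]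
  set φ : ℕ → ℝ → ℝ := fun n y => if 0 < y then log (y + ε n) else 0 with hφ
  have hφm : ∀ n, Measurable (φ n) := fun n =>
    Measurable.ite measurableSet_Ioi (measurable_log.comp (measurable_id.add_const _))
      measurable_const
  have hbound : ∀ n, ∀ x ∈ s, ‖φ n (h x) * w x‖ ≤ ‖log (h x) * w x‖ + log 3 * w x := fun n x hx => by
    have h3 : 0 ≤ log 3 := log_nonneg (by norm_num)
    rw [norm_mul, norm_mul, norm_of_nonneg (hw0 x), ← add_mul]
    refine mul_le_mul_of_nonneg_right ?_ (hw0 x)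
    simp only [hφ]
    split_ifs with hp
    · have a1 : log (h x) ≤ log (h x + ε n) := log_le_log hp (by linarith [hε0 n])
      have a2 : log (h x + ε n) ≤ log 3 :=
        log_le_log (by linarith [hε0 n]) (by linarith [(hb x hx).2, hε1 n])
      rw [Real.norm_eq_abs, Real.norm_eq_abs, abs_le]
      exact ⟨by linarith [neg_abs_le (log (h x))], by linarith [abs_nonneg (log (h x))]⟩
    · rw [norm_zero]; positivity
  have hbi : IntegrableOn (fun x => ‖log (h x) * w x‖ + log 3 * w x) s :=
    hi.norm.add (hw.const_mul _)
  have hm : ∀ n, AEStronglyMeasurable (fun x => φ n (h x) * w x) (volume.restrict s) := fun n =>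
    ((hφm n).comp_aemeasurable hh).aestronglyMeasurable.mul hw.aestronglyMeasurable
  have hbae : ∀ n, ∀ᵐ x ∂volume.restrict s,
      ‖φ n (h x) * w x‖ ≤ ‖log (h x) * w x‖ + log 3 * w x := fun n =>
    (ae_restrict_iff' hs).2 (ae_of_all _ (hbound n))
  have hεt : Filter.Tendsto ε Filter.atTop (nhds 0) := tendsto_one_div_add_atTop_nhds_zero_nat
  have hlim : Filter.Tendsto (fun n => ∫ x in s, φ n (h x) * w x) Filter.atTop
      (nhds (∫ x in s, log (h x) * w x)) := by
    refine tendsto_integral_of_dominated_convergence _ hm hbi hbae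
      ((ae_restrict_iff' hs).2 (ae_of_all _ fun x hx => ?_))
    refine Filter.Tendsto.mul_const _ ?_
    simp only [hφ]
    split_ifs with hp
    · have : Filter.Tendsto (fun n => h x + ε n) Filter.atTop (nhds (h x)) := by
        simpa using hεt.const_add (h x)
      exact this.log hp.ne'
    · have : h x = 0 := le_antisymm (not_lt.1 hp) (hb x hx).1
      simp [this]
  refine le_of_tendsto hlim.neg (Filter.Eventually.of_forall fun n => ?_)
  refine le_trans (neg_le_neg ?_) (hB (ε n) (hε0 n) (hε1 n))
  refine setIntegral_mono_on (hInt _ (hε0 n) (hε1 n)) (hbi.mono' (hm n) (hbae n)) hs fun x hx => ?_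
  refine mul_le_mul_of_nonneg_right ?_ (hw0 x)
  simp only [hφ]
  split_ifs with hp
  · exact le_rfl
  · have : h x = 0 := le_antisymm (not_lt.1 hp) (hb x hx).1
    rw [this, zero_add]
    exact log_nonpos (hε0 n).le (hε1 n)

lemma integrableOn_log_mul_ball {R ε : ℝ} {f k : E3 → ℝ} (hf : ContinuousOn f (Metric.ball 0 R))
    (hε : 0 < ε) (hb : ∀ x ∈ Metric.ball (0 : E3) R, ε ≤ f x ∧ f x ≤ 3) (hk : Continuous k) :
    IntegrableOn (fun x => log (f x) * k x) (Metric.ball 0 R) := by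
  have hl : IntegrableOn (fun x => log (f x)) (Metric.ball 0 R) := by
    have : IsFiniteMeasure (volume.restrict (Metric.ball (0 : E3) R)) :=
      isFiniteMeasure_restrict.2 measure_ball_lt_top.ne
    refine Integrable.of_bound
      ((hf.log fun x hx => (hε.trans_le (hb x hx).1).ne').aestronglyMeasurable measurableSet_ball)
      (|log ε| + |log 3|) ((ae_restrict_iff' measurableSet_ball).2 (ae_of_all _ fun x hx => ?_))
    have a1 : log ε ≤ log (f x) := log_le_log hε (hb x hx).1
    have a2 : log (f x) ≤ log 3 := log_le_log (hε.trans_le (hb x hx).1) (hb x hx).2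
    rw [Real.norm_eq_abs, abs_le]
    exact ⟨by linarith [neg_abs_le (log ε), abs_nonneg (log 3)],
      by linarith [le_abs_self (log 3), abs_nonneg (log ε)]⟩
  exact hl.mul_continuousOn_of_subset hk.continuousOn measurableSet_ball
    (isCompact_closedBall (0 : E3) R) Metric.ball_subset_closedBall

section NavierStokes

variable {u : E3 → ℝ → E3} {P : E3 → ℝ → ℝ} {U : Set (E3 × ℝ)} {R : ℝ}

lemma hfun_eq_affine (hNS : IsNSQ1 u P U) (hR : 0 ≤ R) (hR1 : R ≤ 1) (hJ : 0 < JR u R) :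
    ∃ c₀ c₁ : ℝ, 1 ≤ c₀ ∧ (∀ x t, hfun u R x t = c₀ + c₁ * Gam u x t) ∧
      ∀ z ∈ Qyl (0, 0) R, 0 ≤ hfun u R z.1 z.2 ∧ hfun u R z.1 z.2 ≤ 2 := by
  have hc : ContinuousOn (fun z : E3 × ℝ => Gam u z.1 z.2) (closure (Qyl (0, 0) R)) :=
    fun z hz => (hNS.contDiffAt_Gam
      (hNS.closure_subset hR hR1 hz)).continuousAt.continuousWithinAt
  have hsub : (fun z : E3 × ℝ => Gam u z.1 z.2) '' Qyl (0, 0) R ⊆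
      (fun z : E3 × ℝ => Gam u z.1 z.2) '' closure (Qyl (0, 0) R) := image_mono subset_closure
  have hlo : ∀ z ∈ Qyl (0, 0) R, mR u R ≤ Gam u z.1 z.2 := fun z hz =>
    csInf_le (((isCompact_closure_Qyl R).bddBelow_image hc).mono hsub) (mem_image_of_mem _ hz)
  have hup : ∀ z ∈ Qyl (0, 0) R, Gam u z.1 z.2 ≤ MMR u R := fun z hz =>
    le_csSup (((isCompact_closure_Qyl R).bddAbove_image hc).mono hsub) (mem_image_of_mem _ hz)
  have hJe : JR u R = MMR u R - mR u R := rfl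
  by_cases hcase : -(mR u R) < MMR u R
  · refine ⟨2 * MMR u R / JR u R, -2 / JR u R, ?_, fun x t => ?_, fun z hz => ?_⟩
    · rw [le_div_iff₀ hJ]; linarith
    · rw [hfun, if_pos hcase]; ring
    · rw [hfun, if_pos hcase, le_div_iff₀ hJ, div_le_iff₀ hJ]
      exact ⟨by linarith [hup z hz], by linarith [hlo z hz]⟩
  · refine ⟨-2 * mR u R / JR u R, 2 / JR u R, ?_, fun x t => ?_, fun z hz => ?_⟩
    · rw [le_div_iff₀ hJ]; linarith
    · rw [hfun, if_neg hcase]; ring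
    · rw [hfun, if_neg hcase, le_div_iff₀ hJ, div_le_iff₀ hJ]
      exact ⟨by linarith [hlo z hz], by linarith [hup z hz]⟩

/-- The logarithmic estimate for `h`, with a weight controlled by the quadratic cutoff. -/
lemma neg_setIntegral_log_hfun_le (hNS : IsNSQ1 u P U) (hax : IsAxisym u P U) (hR : 0 < R)
    (hR1 : R ≤ 1) (hJ : 0 < JR u R) {w : E3 → ℝ} {C : ℝ} (hw : Continuous w)
    (hw0 : ∀ x, 0 ≤ w x) (hwC : ∀ x ∈ Metric.ball (0 : E3) R, w x ≤ C * quadCut R x ^ 2)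
    (hC : 0 ≤ C) {t : ℝ} (ht : -R ^ 2 / 4 ≤ t) (ht0 : t < 0) :
    -∫ x in Metric.ball (0 : E3) R, log (hfun u R x t) * w x
      ≤ C * (1600002 * (1 + AA u (0, 0) R) * (5 * R ^ 3)) := by
  obtain ⟨c₀, c₁, hc₀, hh, hb⟩ := hfun_eq_affine hNS hR.le hR1 hJ
  have hA := AA_nonneg u (0, 0) hR.le
  have htm : t ∈ Ioo (-R ^ 2) 0 := ⟨by nlinarith [pow_pos hR 2], ht0⟩
  have hbt : ∀ x ∈ Metric.ball (0 : E3) R, 0 ≤ hfun u R x t ∧ hfun u R x t ≤ 2 := fun x hx =>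
    hb (x, t) (mem_Qyl.2 ⟨hx, htm⟩)
  have hcont : ContinuousOn (fun x => hfun u R x t) (Metric.ball 0 R) := by
    simp only [hh]
    refine continuousOn_const.add (continuousOn_const.mul fun x hx => ?_)
    have hz := hNS.closure_subset hR.le hR1 (subset_closure (mem_Qyl.2 ⟨hx, htm⟩))
    exact (ContinuousAt.comp (f := fun y : E3 => (y, t)) (hNS.contDiffAt_Gam hz).continuousAt
      (by fun_prop)).continuousWithinAt
  have hInt : ∀ k : E3 → ℝ, Continuous k → ∀ ε, 0 < ε → ε ≤ 1 →
      IntegrableOn (fun x => log (hfun u R x t + ε) * k x) (Metric.ball 0 R) := fun k hk ε h0 h1 =>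
    integrableOn_log_mul_ball (hcont.add continuousOn_const) h0
      (fun x hx => ⟨by linarith [(hbt x hx).1], by linarith [(hbt x hx).2]⟩) hk
  refine neg_setIntegral_log_le_of_forall measurableSet_ball
    (hcont.aemeasurable measurableSet_ball) hbt (integrableOn_ball hw R) hw0 (by positivity)
    (hInt w hw) fun ε h0 h1 => ?_
  have hS : Continuous fun x => quadCut R x ^ 2 := (continuous_quadCut R).pow 2
  have hmain := integral_neg_log_affine_le hNS hax hR hR1 h0 h1 hc₀
    (fun z hz => by rw [← hh]; exact hb z hz) ht ht0
  simp only [← hh] at hmain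
  have hW := (integral_quadCut_sq_le R).trans (volume_le_five_mul_pow hR)
  have hlog3 : log 3 ≤ 2 := by linarith [log_le_sub_one_of_pos (show (0 : ℝ) < 3 by norm_num)]
  have hW0 : 0 ≤ ∫ x in Metric.ball (0 : E3) R, quadCut R x ^ 2 :=
    integral_nonneg fun _ => sq_nonneg _
  have i1 : IntegrableOn (fun x => C * (log 3 * quadCut R x ^ 2)) (Metric.ball 0 R) :=
    ((integrableOn_ball hS R).const_mul _).const_mul _
  have i2 : IntegrableOn (fun x => C * (log (hfun u R x t + ε) * quadCut R x ^ 2))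
      (Metric.ball 0 R) := (hInt _ hS ε h0 h1).const_mul _
  calc -∫ x in Metric.ball (0 : E3) R, log (hfun u R x t + ε) * w x
      = ∫ x in Metric.ball (0 : E3) R, -(log (hfun u R x t + ε) * w x) := (integral_neg _).symm
    _ ≤ ∫ x in Metric.ball (0 : E3) R, (C * (log 3 * quadCut R x ^ 2)
          - C * (log (hfun u R x t + ε) * quadCut R x ^ 2)) := by
        refine setIntegral_mono_on (hInt w hw ε h0 h1).neg (i1.sub i2) measurableSet_ball
          fun x hx => ?_
        have a2 : log (hfun u R x t + ε) ≤ log 3 :=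
          log_le_log (by linarith [(hbt x hx).1]) (by linarith [(hbt x hx).2])
        have a3 : 0 ≤ log 3 * w x := mul_nonneg (log_nonneg (by norm_num)) (hw0 x)
        nlinarith [mul_le_mul_of_nonneg_left (hwC x hx) (sub_nonneg.2 a2)]
    _ = C * (log 3 * ∫ x in Metric.ball (0 : E3) R, quadCut R x ^ 2)
          - C * ∫ x in Metric.ball (0 : E3) R, log (hfun u R x t + ε) * quadCut R x ^ 2 := by
        rw [integral_sub i1 i2, integral_const_mul, integral_const_mul, integral_const_mul]
    _ ≤ C * (1600002 * (1 + AA u (0, 0) R) * ∫ x in Metric.ball (0 : E3) R, quadCut R x ^ 2) := by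
        rw [← mul_sub]
        refine mul_le_mul_of_nonneg_left ?_ hC
        nlinarith [mul_le_mul_of_nonneg_right hlog3 hW0, mul_nonneg hA hW0]
    _ ≤ _ := by gcongr

end NavierStokes

/-- weak Harnack inequality for `h`. -/
theorem weak_harnack (C₀ : ℝ) (hC₀ : 0 < C₀) :
    ∃ N : ℝ, ∀ κ : ℝ → ℝ,
      ContDiff ℝ (⊤ : ℕ∞) κ →
      (∀ s : ℝ, 0 ≤ κ s ∧ κ s ≤ 1) →
      (∀ s₁ s₂ : ℝ, 0 ≤ s₁ → s₁ ≤ s₂ → κ s₂ ≤ κ s₁) →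
      (∀ s : ℝ, 0 ≤ s → -C₀ ≤ deriv κ s) →
      (∀ s : ℝ, 0 ≤ s → s ≤ 1/2 → κ s = 1) →
      (∀ s : ℝ, 1 ≤ s → κ s = 0) →
      (∫ x : E3, (κ ‖x‖) ^ 2) = 1 →
      ∀ (u : E3 → ℝ → E3) (P : E3 → ℝ → ℝ) (U : Set (E3 × ℝ)),
        IsNSQ1 u P U → IsAxisym u P U →
        ∀ R : ℝ, 0 < R → R ≤ 1/4 → 0 < JR u R →
        ∀ t : ℝ, -R ^ 2/4 ≤ t → t < 0 →
          -∫ x : E3, Real.log (hfun u R x t) * (R ^ (-(3:ℝ)/2) * κ (‖x‖ / R)) ^ 2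
            ≤ N * (1 + AA u (0, 0) R) ^ 3 := by
  refine ⟨C₀ ^ 2 * 1600002 * 5, ?_⟩
  intro κ hκ hκb _ hκd _ hκ1 _ u P U hNS hax R hR hR4 hJ t ht ht0
  have hA := AA_nonneg u (0, 0) hR.le
  have hc : (R ^ (-(3:ℝ)/2)) ^ 2 = (R ^ 3)⁻¹ := by
    rw [← rpow_natCast, ← rpow_mul hR.le, ← rpow_natCast R 3, ← rpow_neg hR.le]
    norm_num
  have hout : ∀ x ∉ Metric.ball (0 : E3) R,
      log (hfun u R x t) * (R ^ (-(3:ℝ)/2) * κ (‖x‖ / R)) ^ 2 = 0 := fun x hx => by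
    rw [Metric.mem_ball, dist_zero_right, not_lt] at hx
    rw [hκ1 _ ((one_le_div hR).2 hx)]
    simp
  rw [← setIntegral_eq_integral_of_forall_compl_eq_zero hout]
  refine (neg_setIntegral_log_hfun_le hNS hax hR (by linarith) hJ (C := C₀ ^ 2 * (R ^ 3)⁻¹)
    ((continuous_const.mul (hκ.continuous.comp (continuous_norm.div_const R))).pow 2)
    (fun _ => sq_nonneg _) (fun x hx => ?_) (by positivity) ht ht0).trans ?_
  · rw [Metric.mem_ball, dist_zero_right] at hx
    change (R ^ (-(3:ℝ)/2) * κ (‖x‖ / R)) ^ 2 ≤ _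
    rw [mul_pow, hc, mul_comm (C₀ ^ 2), mul_assoc, ← mul_pow]
    refine mul_le_mul_of_nonneg_left (pow_le_pow_left₀ (hκb _).1 ?_ 2) (by positivity)
    have hs0 : 0 ≤ ‖x‖ / R := by positivity
    have hs1 : ‖x‖ / R ≤ 1 := (div_le_one hR).2 hx.le
    refine (le_mul_one_sub_of_deriv (hκ.differentiable (by simp)) hκd (hκ1 1 le_rfl)
      hs0 hs1).trans (mul_le_mul_of_nonneg_left ?_ hC₀.le)
    refine le_trans ?_ (le_max_right _ _)
    rw [← div_pow]
    nlinarith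
  · have hR3 : (R ^ 3)⁻¹ * R ^ 3 = 1 := inv_mul_cancel₀ (by positivity)
    calc C₀ ^ 2 * (R ^ 3)⁻¹ * (1600002 * (1 + AA u (0, 0) R) * (5 * R ^ 3))
        = C₀ ^ 2 * 1600002 * 5 * (1 + AA u (0, 0) R) * ((R ^ 3)⁻¹ * R ^ 3) := by ring
      _ = C₀ ^ 2 * 1600002 * 5 * (1 + AA u (0, 0) R) := by rw [hR3, mul_one]
      _ ≤ _ := mul_le_mul_of_nonneg_left (le_self_pow₀ (by linarith) (by norm_num))
        (by positivity)
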